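/- arXiv:1510.08878 — 5 statements merged into one kernel-verified Lean document; each statement's English description precedes it below -/
import Mathlib

section
/- If a < b ≤ -1 and f is a Lebesgue-integrable real-valued function on the interval (a,b) that is nonzero on a set of positive Lebesgue measure, then sup_{n ≥ 0} ∫_a^b xⁿ f(x) dx = ∞ and inf_{n ≥ 0} ∫_a^b xⁿ f(x) dx = -∞ (i.e., the sequence of moments ∫_a^b xⁿ f(x) dx is unbounded above and unbounded below). -/
open MeasureTheory

lemma um_exp (y : ℝ) : HasSum (fun n : ℕ => y ^ n / (n.factorial : ℝ)) (Real.exp y) := by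
  rw [Real.exp_eq_exp_ℝ]
  exact NormedSpace.expSeries_div_hasSum_exp y

lemma um_abs {a b x : ℝ} (hb : b ≤ -1) (hx : x ∈ Set.Ioo a b) : |x| ≤ |a| := by
  rw [abs_of_neg (by linarith [hx.2]), abs_of_neg (by linarith [hx.1, hx.2])]
  linarith [hx.1]

lemma um_int (a b : ℝ) (hb : b ≤ -1) (f : ℝ → ℝ)
    (hf : IntegrableOn f (Set.Ioo a b)) (m : ℕ) :
    IntegrableOn (fun x => x ^ m * f x) (Set.Ioo a b) := by
  refine Integrable.bdd_mul (c := |a| ^ m) hf (by fun_prop) ?_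
  filter_upwards [ae_restrict_mem measurableSet_Ioo] with x hx
  rw [norm_pow, Real.norm_eq_abs]
  exact pow_le_pow_left₀ (abs_nonneg _) (um_abs hb hx) m

lemma um_series (a b : ℝ) (hb : b ≤ -1) (f : ℝ → ℝ)
    (hf : IntegrableOn f (Set.Ioo a b)) (c : ℝ) (N : ℕ) :
    HasSum (fun k : ℕ => c ^ k / (k.factorial : ℝ) * ∫ x in Set.Ioo a b, x ^ (N * k) * f x)
      (∫ x in Set.Ioo a b, Real.exp (c * x ^ N) * f x) := by
  have key := hasSum_integral_of_summable_integral_norm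
    (μ := volume.restrict (Set.Ioo a b))
    (F := fun (k : ℕ) x => c ^ k / (k.factorial : ℝ) * (x ^ (N * k) * f x))
    (fun k => (um_int a b hb f hf (N * k)).const_mul _) ?_
  · have e1 : (fun x => ∑' k : ℕ, c ^ k / (k.factorial : ℝ) * (x ^ (N * k) * f x))
        = fun x => Real.exp (c * x ^ N) * f x := by
      funext x
      rw [← ((um_exp (c * x ^ N)).mul_right (f x)).tsum_eq]
      congr 1
      funext k
      rw [mul_pow, ← pow_mul]
      ring
    rw [e1] at key
    simpa only [integral_const_mul] using key
  · refine Summable.of_nonneg_of_le (fun k => integral_nonneg fun x => norm_nonneg _) (fun k => ?_)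
      (((um_exp (|c| * |a| ^ N)).mul_right (∫ x in Set.Ioo a b, |f x|)).summable)
    rw [← integral_const_mul]
    refine integral_mono_ae ((um_int a b hb f hf (N * k)).const_mul _).norm
      (hf.abs.const_mul _) ?_
    filter_upwards [ae_restrict_mem measurableSet_Ioo] with x hx
    simp only [norm_mul, norm_div, norm_pow, Real.norm_eq_abs, Nat.abs_cast]
    rw [mul_pow, ← pow_mul, ← mul_assoc, mul_div_right_comm]
    have := um_abs hb hx
    gcongr

lemma um_stirling (n : ℕ) : ((n + 1).factorial : ℝ) * Real.exp (n + 1 : ℕ) ≤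
    Stirling.stirlingSeq 1 * (n + 2) * ((n + 1 : ℕ) : ℝ) ^ (n + 1) := by
  have h : Stirling.stirlingSeq (n + 1) ≤ Stirling.stirlingSeq 1 :=
    Stirling.stirlingSeq'_antitone (Nat.zero_le n)
  have hs : √(2 * ((n + 1 : ℕ) : ℝ)) ≤ n + 2 := by
    rw [Real.sqrt_le_left (by positivity)]
    push_cast
    nlinarith [(Nat.cast_nonneg n : (0 : ℝ) ≤ n)]
  have hp : 0 ≤ Stirling.stirlingSeq 1 := by rw [Stirling.stirlingSeq_one]; positivity
  have e : ((n + 1).factorial : ℝ) * Real.exp (n + 1 : ℕ) =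
      Stirling.stirlingSeq (n + 1) * √(2 * ((n + 1 : ℕ) : ℝ)) * ((n + 1 : ℕ) : ℝ) ^ (n + 1) := by
    unfold Stirling.stirlingSeq
    have : Real.exp ((n + 1 : ℕ) : ℝ) = Real.exp 1 ^ (n + 1) := by
      rw [← Real.exp_nat_mul, mul_one]
    rw [this, div_pow]
    have h1 : √(2 * ((n + 1 : ℕ) : ℝ)) ≠ 0 := by positivity
    have h2 : ((n + 1 : ℕ) : ℝ) ≠ 0 := by positivity
    field_simp
  rw [e]
  gcongr

lemma um_growth (a b : ℝ) (hb : b ≤ -1) (f : ℝ → ℝ)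
    (hf : IntegrableOn f (Set.Ioo a b)) (C : ℝ)
    (hC : ∀ n : ℕ, ∫ x in Set.Ioo a b, x ^ n * f x ≤ C) :
    ∃ K : ℝ, 0 ≤ K ∧ ∀ n : ℕ, |∫ x in Set.Ioo a b, x ^ n * f x| ≤ K * (n + 1) := by
  wlog hC0 : 0 ≤ C generalizing C
  · exact this 0 (fun n => (hC n).trans (by linarith)) le_rfl
  set m : ℕ → ℝ := fun n => ∫ x in Set.Ioo a b, x ^ n * f x with hm
  set L := ∫ x in Set.Ioo a b, |f x| with hL
  have hL0 : 0 ≤ L := integral_nonneg fun x => abs_nonneg _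
  have hS0 : 0 ≤ Stirling.stirlingSeq 1 := by rw [Stirling.stirlingSeq_one]; positivity
  have main : ∀ s : ℝ, 0 ≤ s → ∀ n : ℕ,
      s ^ n / (n.factorial : ℝ) * (C - m n) ≤ (C + L) * Real.exp s := by
    intro s hs n
    have h1 := um_series a b hb f hf s 1
    simp only [one_mul, pow_one] at h1
    have h2 := ((um_exp s).mul_right C).sub h1
    have h3 : ∀ k : ℕ, 0 ≤ s ^ k / (k.factorial : ℝ) * C - s ^ k / (k.factorial : ℝ) *
        ∫ x in Set.Ioo a b, x ^ k * f x := by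
      intro k
      rw [← mul_sub]
      exact mul_nonneg (by positivity) (sub_nonneg.2 (hC k))
    have h4 := le_hasSum h2 n (fun k _ => h3 k)
    have h5 : |∫ x in Set.Ioo a b, Real.exp (s * x) * f x| ≤ L := by
      rw [← Real.norm_eq_abs]
      refine norm_integral_le_of_norm_le hf.abs ?_
      filter_upwards [ae_restrict_mem measurableSet_Ioo] with x hx
      rw [norm_mul, Real.norm_eq_abs, Real.norm_eq_abs, abs_of_pos (Real.exp_pos _)]
      have : Real.exp (s * x) ≤ 1 := Real.exp_le_one_iff.2
        (mul_nonpos_of_nonneg_of_nonpos hs (by linarith [hx.2]))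
      nlinarith [abs_nonneg (f x)]
    have h6 := neg_le_of_abs_le h5
    have h7 : 1 ≤ Real.exp s := Real.one_le_exp hs
    have h8 : L ≤ L * Real.exp s := by nlinarith
    rw [mul_sub]
    refine h4.trans ?_
    linarith
  refine ⟨C + |m 0| + 2 * (Stirling.stirlingSeq 1 * (C + L)), by positivity, fun n => ?_⟩
  rcases n with _ | n
  · have : 0 ≤ Stirling.stirlingSeq 1 * (C + L) := by positivity
    change |m 0| ≤ _
    push_cast
    linarith
  · have h := main ((n + 1 : ℕ) : ℝ) (by positivity) (n + 1)
    have hst := um_stirling n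
    have hp : (0 : ℝ) < ((n + 1 : ℕ) : ℝ) ^ (n + 1) := by positivity
    have hfac : (0 : ℝ) < ((n + 1).factorial : ℝ) := by positivity
    rw [div_mul_eq_mul_div, div_le_iff₀ hfac] at h
    have h2 : C - m (n + 1) ≤ Stirling.stirlingSeq 1 * (n + 2) * (C + L) := by
      refine le_of_mul_le_mul_left (h.trans ?_) hp
      have := mul_le_mul_of_nonneg_left hst (by positivity : 0 ≤ C + L)
      linarith
    have h3 := hC (n + 1)
    change m (n + 1) ≤ C at h3
    change |m (n + 1)| ≤ _
    have h4 : 0 ≤ Stirling.stirlingSeq 1 * (C + L) := by positivity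
    have hn : (0 : ℝ) ≤ n := Nat.cast_nonneg n
    have h5 := abs_nonneg (m 0)
    push_cast
    rw [abs_le]
    constructor <;> nlinarith [mul_nonneg h4 hn, mul_nonneg hC0 hn, mul_nonneg h5 hn]

open Filter Topology in
lemma um_tail (a b : ℝ) (hb : b ≤ -1) (f : ℝ → ℝ)
    (hf : IntegrableOn f (Set.Ioo a b)) (K : ℝ) (hK : 0 ≤ K)
    (h : ∀ n : ℕ, |∫ x in Set.Ioo a b, x ^ n * f x| ≤ K * (n + 1)) (r : ℝ) (hr : 1 < r) :
    ∫ x in Set.Ioo a b, (Set.Ioi (-r)).indicator f x = ∫ x in Set.Ioo a b, f x := by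
  have hr0 : 0 < r := by linarith
  have T1 : Tendsto (fun N : ℕ => ∫ x in Set.Ioo a b, Real.exp (-(-1 / r) ^ N * x ^ N) * f x)
      atTop (𝓝 (∫ x in Set.Ioo a b, (Set.Ioi (-r)).indicator f x)) := by
    refine tendsto_integral_of_dominated_convergence (fun x => |f x|) (fun N => ?_) hf.abs
      (fun N => ?_) ?_
    · exact AEStronglyMeasurable.mul (by fun_prop) hf.aestronglyMeasurable
    · filter_upwards [ae_restrict_mem measurableSet_Ioo] with x hx
      rw [norm_mul, Real.norm_eq_abs, Real.norm_eq_abs, abs_of_pos (Real.exp_pos _)]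
      have : Real.exp (-(-1 / r) ^ N * x ^ N) ≤ 1 := by
        rw [Real.exp_le_one_iff, neg_mul, ← mul_pow]
        have : 0 ≤ -1 / r * x := by
          rw [div_mul_eq_mul_div]
          exact div_nonneg (by linarith [hx.2]) hr0.le
        have := pow_nonneg this N
        linarith
      nlinarith [abs_nonneg (f x)]
    · have hne : ∀ᵐ x ∂(volume.restrict (Set.Ioo a b)), x ≠ -r :=
        ae_restrict_of_ae (Measure.ae_ne volume (-r))
      filter_upwards [ae_restrict_mem measurableSet_Ioo, hne] with x hx hxr
      have e : ∀ N : ℕ, -(-1 / r) ^ N * x ^ N = -((-x / r) ^ N) := by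
        intro N
        rw [neg_mul, ← mul_pow]
        congr 2
        ring
      simp only [e]
      have hx0 : 0 ≤ -x / r := div_nonneg (by linarith [hx.2]) hr0.le
      rcases lt_or_gt_of_ne hxr with h1 | h1
      · have hx1 : 1 < -x / r := by rw [lt_div_iff₀ hr0]; linarith
        rw [Set.indicator_of_notMem (by simpa using h1.le)]
        have := (Real.tendsto_exp_neg_atTop_nhds_zero.comp
          (tendsto_pow_atTop_atTop_of_one_lt hx1)).mul_const (f x)
        simpa using this
      · have hx1 : -x / r < 1 := by rw [div_lt_iff₀ hr0]; linarith
        rw [Set.indicator_of_mem (by simpa using h1)]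
        have := ((Real.continuous_exp.tendsto _).comp
          (tendsto_pow_atTop_nhds_zero_of_lt_one hx0 hx1).neg).mul_const (f x)
        simpa using this
  have T2 : Tendsto (fun N : ℕ => ∫ x in Set.Ioo a b, Real.exp (-(-1 / r) ^ N * x ^ N) * f x)
      atTop (𝓝 (∫ x in Set.Ioo a b, f x)) := by
    rw [tendsto_iff_norm_sub_tendsto_zero]
    have hq0 : 0 ≤ 1 / r := by positivity
    have hq1 : 1 / r < 1 := by rw [div_lt_one hr0]; exact hr
    have B : ∀ N : ℕ, ‖(∫ x in Set.Ioo a b, Real.exp (-(-1 / r) ^ N * x ^ N) * f x) -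
        ∫ x in Set.Ioo a b, f x‖ ≤ K * (N + 1) * (1 / r) ^ N * Real.exp 1 := by
      intro N
      have hs := um_series a b hb f hf (-(-1 / r) ^ N) N
      have hs1 := (hasSum_nat_add_iff' 1).2 hs
      simp only [Finset.sum_range_one, pow_zero, Nat.factorial_zero, Nat.cast_one, div_one,
        mul_zero, one_mul] at hs1
      have hg := (um_exp ((1 / r) ^ N)).mul_left (K * (N + 1) * (1 / r) ^ N)
      refine (hs1.norm_le_of_bounded hg (fun k => ?_)).trans ?_
      · have hh := h (N * (k + 1))
        rw [norm_mul, norm_div, norm_pow, norm_neg, norm_pow, norm_div, norm_neg, norm_one,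
          Real.norm_eq_abs, Real.norm_eq_abs, Real.norm_eq_abs, abs_of_pos hr0, Nat.abs_cast]
        have hk : (0 : ℝ) < (k.factorial : ℝ) := by positivity
        have hQ : 0 ≤ ((1 / r) ^ N) ^ (k + 1) / ((k + 1).factorial : ℝ) := by positivity
        refine (mul_le_mul_of_nonneg_left hh hQ).trans ?_
        rw [Nat.factorial_succ]
        push_cast
        have e2 : K * (↑N + 1) * (1 / r) ^ N * (((1 / r) ^ N) ^ k / (k.factorial : ℝ)) =
            ((1 / r) ^ N) ^ (k + 1) / (((k : ℝ) + 1) * k.factorial) *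
              (K * ((N + 1) * (k + 1))) := by
          have : (k : ℝ) + 1 ≠ 0 := by positivity
          generalize (1 / r) ^ N = Q
          field_simp
          ring
        rw [e2]
        have : (N : ℝ) * (k + 1) + 1 ≤ (N + 1) * (k + 1) := by
          nlinarith [(Nat.cast_nonneg k : (0 : ℝ) ≤ k)]
        gcongr
      · have : (1 / r) ^ N ≤ 1 := pow_le_one₀ hq0 hq1.le
        gcongr
    refine squeeze_zero (fun N => norm_nonneg _) B ?_
    have t1 := tendsto_self_mul_const_pow_of_lt_one hq0 hq1
    have t2 := tendsto_pow_atTop_nhds_zero_of_lt_one hq0 hq1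
    have := ((t1.add t2).const_mul K).mul_const (Real.exp 1)
    simp only [add_zero, mul_zero, zero_mul] at this
    refine this.congr (fun N => ?_)
    ring
  exact tendsto_nhds_unique T1 T2

open Filter Topology in
lemma um_zero (a b : ℝ) (hb : b ≤ -1) (f : ℝ → ℝ)
    (hf : IntegrableOn f (Set.Ioo a b)) (C : ℝ)
    (hC : ∀ n : ℕ, ∫ x in Set.Ioo a b, x ^ n * f x ≤ C) :
    volume {x ∈ Set.Ioo a b | f x ≠ 0} = 0 := by
  obtain ⟨K, hK, h⟩ := um_growth a b hb f hf C hC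
  set g := (Set.Ioo a b).indicator f with hg
  have hgi : Integrable g := (integrable_indicator_iff measurableSet_Ioo).2 hf
  have hJ : ∀ u : ℝ, u < -1 → ∫ x in Set.Iic u, g x = 0 := by
    intro u hu
    have ht := um_tail a b hb f hf K hK h (-u) (by linarith)
    rw [neg_neg, ← integral_indicator measurableSet_Ioo, ← integral_indicator measurableSet_Ioo,
      Set.indicator_indicator, Set.inter_comm, ← Set.indicator_indicator,
      integral_indicator measurableSet_Ioi] at ht
    have := integral_add_compl (measurableSet_Iic (a := u)) hgi
    rw [Set.compl_Iic] at this
    change ∫ x in Set.Ioi u, g x = ∫ x, g x at ht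
    linarith
  have hI : ∀ x : ℝ, x < -1 → ∫ t in (-2 : ℝ)..x, g t = 0 := by
    intro x hx
    rw [← intervalIntegral.integral_Iic_sub_Iic hgi.integrableOn hgi.integrableOn,
      hJ x hx, hJ (-2) (by norm_num), sub_zero]
  have hae := _root_.LocallyIntegrable.ae_hasDerivAt_integral hgi.locallyIntegrable
  have : ∀ᵐ x : ℝ, ¬ (x ∈ Set.Ioo a b ∧ f x ≠ 0) := by
    filter_upwards [hae] with x hx
    rintro ⟨hxm, hfx⟩
    have hx1 : x < -1 := by linarith [hxm.2]
    have h0 : HasDerivAt (fun y => ∫ t in (-2 : ℝ)..y, g t) 0 x := by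
      refine (hasDerivAt_const x (0 : ℝ)).congr_of_eventuallyEq ?_
      filter_upwards [Iio_mem_nhds hx1] with y hy using hI y hy
    have := (hx (-2)).unique h0
    rw [hg, Set.indicator_of_mem hxm] at this
    exact hfx this
  simpa only [ae_iff, not_not] using this

theorem unbounded_moments (a b : ℝ) (hab : a < b) (hb : b ≤ -1) (f : ℝ → ℝ)
    (hf : IntegrableOn f (Set.Ioo a b))
    (hne : 0 < volume {x ∈ Set.Ioo a b | f x ≠ 0}) :
    ¬ BddAbove (Set.range fun n : ℕ => ∫ x in Set.Ioo a b, x ^ n * f x) ∧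
    ¬ BddBelow (Set.range fun n : ℕ => ∫ x in Set.Ioo a b, x ^ n * f x) := by
  constructor
  · rintro ⟨C, hC⟩
    exact hne.ne' (um_zero a b hb f hf C fun n => hC ⟨n, rfl⟩)
  · rintro ⟨C, hC⟩
    have := um_zero a b hb (fun x => - f x) hf.neg (-C) fun n => by
      have := hC ⟨n, rfl⟩
      simp only [mul_neg, integral_neg]
      exact neg_le_neg this
    simp only [ne_eq, neg_eq_zero] at this
    exact hne.ne' this
end

section
/- Suppose a < b ≤ -1, f is a Lebesgue-integrable real-valued function on (a,b), and there is an open interval I₀ ⊆ (a,b) on which f is (almost everywhere) strictly positive. Then there exist a real number m > 1, a real number c > 0, and a strictly increasing sequence of positive integers (n_k) such that ∫_a^b x^{n_k} f(x) dx ≥ c·m^k for all k ≥ 1; in particular these moments tend to infinity. -/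
open MeasureTheory

lemma aux_int (a b : ℝ) (hb : b ≤ -1) (f : ℝ → ℝ)
    (hf : IntegrableOn f (Set.Ioo a b)) (g : ℝ → ℝ) (hg : Measurable g) (R : ℝ)
    (hR : ∀ x ∈ Set.Ioo a b, |g x| ≤ R) :
    IntegrableOn (fun x => g x * f x) (Set.Ioo a b) := by
  refine Integrable.bdd_mul (c := R) hf hg.aestronglyMeasurable ?_
  filter_upwards [ae_restrict_mem measurableSet_Ioo] with x hx
  simpa using hR x hx

lemma aux_abs (a b : ℝ) (hb : b ≤ -1) (x : ℝ) (hx : x ∈ Set.Ioo a b) (n : ℕ) :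
    |x ^ n| ≤ |a| ^ n := by
  rw [abs_pow]
  have h1 : |x| = -x := abs_of_neg (by linarith [hx.2])
  have h2 : |a| = -a := abs_of_neg (by linarith [hx.1, hx.2])
  have : |x| ≤ |a| := by rw [h1, h2]; linarith [hx.1]
  gcongr

lemma aux_sum (a b : ℝ) (hb : b ≤ -1) (f : ℝ → ℝ)
    (hf : IntegrableOn f (Set.Ioo a b)) (c : ℕ → ℝ) (p : ℕ → ℕ) (F : ℝ → ℝ)
    (hs : Summable fun k => |c k| * |a| ^ (p k))
    (hF : ∀ x, HasSum (fun k => c k * x ^ (p k)) (F x)) :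
    HasSum (fun k => c k * ∫ x in Set.Ioo a b, x ^ (p k) * f x)
      (∫ x in Set.Ioo a b, F x * f x) := by
  have hi : ∀ n : ℕ, IntegrableOn (fun x => x ^ n * f x) (Set.Ioo a b) := fun n =>
    aux_int a b hb f hf (fun x => x ^ n) (by fun_prop) (|a| ^ n)
      (fun x hx => aux_abs a b hb x hx n)
  have := hasSum_integral_of_dominated_convergence
    (μ := volume.restrict (Set.Ioo a b)) (F := fun k x => c k * (x ^ (p k) * f x))
    (f := fun x => F x * f x)
    (fun k x => |c k| * |a| ^ (p k) * |f x|) (fun k => ((hi (p k)).const_mul (c k)).1)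
    (fun k => by
      filter_upwards [ae_restrict_mem measurableSet_Ioo] with x hx
      rw [Real.norm_eq_abs, abs_mul, abs_mul, ← mul_assoc]
      have := aux_abs a b hb x hx (p k)
      gcongr)
    (Filter.Eventually.of_forall fun x => hs.mul_right _)
    (by
      simp_rw [tsum_mul_right]
      exact (Integrable.abs hf).const_mul _)
    (Filter.Eventually.of_forall fun x => by
      simpa [mul_assoc] using (hF x).mul_right (f x))
  simpa [integral_const_mul] using this

lemma aux_lower (a b : ℝ) (hb : b ≤ -1) (f : ℝ → ℝ)
    (hf : IntegrableOn f (Set.Ioo a b)) (C B : ℝ) (hC0 : 0 ≤ C)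
    (hB : B = ∫ x in Set.Ioo a b, |f x|)
    (hC : ∀ n : ℕ, ∫ x in Set.Ioo a b, x ^ n * f x ≤ C) (t : ℝ) (ht : 0 ≤ t) (n : ℕ) :
    t ^ n / n.factorial * (C - ∫ x in Set.Ioo a b, x ^ n * f x) ≤ (C + B) * Real.exp t := by
  have hexp : ∀ y : ℝ, HasSum (fun k : ℕ => y ^ k / k.factorial) (Real.exp y) := by
    intro y
    rw [Real.exp_eq_exp_ℝ]
    exact NormedSpace.expSeries_div_hasSum_exp y
  have h1 := aux_sum a b hb f hf (fun k => t ^ k / k.factorial) id (fun x => Real.exp (t * x))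
    (by
      refine (hexp (t * |a|)).summable.congr fun k => ?_
      rw [abs_of_nonneg (by positivity : 0 ≤ t ^ k / (k.factorial : ℝ)), mul_pow]
      simp only [id]; ring)
    (fun x => by
      have := hexp (t * x)
      convert this using 2 with k
      rw [mul_pow]
      simp only [id]; ring)
  have h2 := ((hexp t).mul_right C).sub h1
  have h3 := le_hasSum h2 n (fun k _ => by
    rw [← mul_sub]
    exact mul_nonneg (by positivity) (by simpa using hC k))
  rw [← mul_sub] at h3
  have hB0 : 0 ≤ B := by rw [hB]; exact integral_nonneg fun x => abs_nonneg _
  have h4 : -B ≤ ∫ x in Set.Ioo a b, Real.exp (t * x) * f x := by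
    rw [hB]
    refine (abs_le.1 ((abs_integral_le_integral_abs).trans ?_)).1
    refine setIntegral_mono_on ?_ (Integrable.abs hf) measurableSet_Ioo ?_
    · refine Integrable.abs (aux_int a b hb f hf _ (by fun_prop) 1 ?_)
      intro x hx
      rw [abs_of_pos (Real.exp_pos _)]
      exact Real.exp_le_one_iff.2 (mul_nonpos_of_nonneg_of_nonpos ht (by linarith [hx.2]))
    · intro x hx
      rw [abs_mul, abs_of_pos (Real.exp_pos _)]
      exact mul_le_of_le_one_left (abs_nonneg _)
        (Real.exp_le_one_iff.2 (mul_nonpos_of_nonneg_of_nonpos ht (by linarith [hx.2])))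
  have h5 : B ≤ B * Real.exp t := le_mul_of_one_le_right hB0 (Real.one_le_exp ht)
  simp only [id] at h3
  linarith

lemma aux_fact (n : ℕ) (hn : 1 ≤ n) :
    (n.factorial : ℝ) * Real.exp n ≤ Real.exp 1 * n * (n : ℝ) ^ n := by
  induction n, hn using Nat.le_induction with
  | base => simp
  | succ n hn ih =>
    have hn' : (0 : ℝ) < n := by exact_mod_cast hn
    have key : Real.exp 1 * (n : ℝ) ^ (n + 1) ≤ ((n : ℝ) + 1) ^ (n + 1) := by
      have h := Real.add_one_le_exp (-(1 / ((n : ℝ) + 1)))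
      have e : -(1 / ((n : ℝ) + 1)) + 1 = n / (n + 1) := by field_simp; ring
      rw [e] at h
      have h2 := pow_le_pow_left₀ (by positivity) h (n + 1)
      rw [← Real.exp_nat_mul, div_pow] at h2
      have e2 : ((n + 1 : ℕ) : ℝ) * -(1 / ((n : ℝ) + 1)) = -1 := by push_cast; field_simp
      rw [e2, div_le_iff₀ (by positivity), Real.exp_neg] at h2
      have := Real.exp_pos 1
      calc _ ≤ Real.exp 1 * ((Real.exp 1)⁻¹ * ((n : ℝ) + 1) ^ (n + 1)) := by gcongr
        _ = _ := by field_simp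
    rw [Nat.factorial_succ]
    push_cast
    rw [Real.exp_add]
    calc ((n : ℝ) + 1) * n.factorial * (Real.exp n * Real.exp 1)
        = (n + 1) * Real.exp 1 * (n.factorial * Real.exp n) := by ring
      _ ≤ (n + 1) * Real.exp 1 * (Real.exp 1 * n * (n : ℝ) ^ n) := by gcongr
      _ = (n + 1) * Real.exp 1 * (Real.exp 1 * (n : ℝ) ^ (n + 1)) := by ring
      _ ≤ (n + 1) * Real.exp 1 * ((n : ℝ) + 1) ^ (n + 1) := by gcongr
      _ = _ := by ring

lemma aux_poly (a b : ℝ) (hb : b ≤ -1) (f : ℝ → ℝ)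
    (hf : IntegrableOn f (Set.Ioo a b)) (C : ℝ) (hC0 : 0 ≤ C)
    (hC : ∀ n : ℕ, ∫ x in Set.Ioo a b, x ^ n * f x ≤ C) :
    ∃ K : ℝ, 0 ≤ K ∧ ∀ n : ℕ, 1 ≤ n → |∫ x in Set.Ioo a b, x ^ n * f x| ≤ K * n := by
  set B := ∫ x in Set.Ioo a b, |f x| with hB
  have hB0 : 0 ≤ B := integral_nonneg fun x => abs_nonneg _
  have he : 1 ≤ Real.exp 1 := Real.one_le_exp (by norm_num)
  refine ⟨(C + B) * Real.exp 1, by positivity, fun n hn => ?_⟩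
  have hn' : (1 : ℝ) ≤ n := by exact_mod_cast hn
  have h := aux_lower a b hb f hf C B hC0 hB hC n (by positivity) n
  have hfac := aux_fact n hn
  have hnn : (0 : ℝ) < (n : ℝ) ^ n := by positivity
  have hff : (0 : ℝ) < n.factorial := by positivity
  have hMC := hC n
  set M := ∫ x in Set.Ioo a b, x ^ n * f x
  rw [div_mul_eq_mul_div, div_le_iff₀ hff] at h
  have h2 : (n : ℝ) ^ n * (C - M) ≤ (n : ℝ) ^ n * ((C + B) * Real.exp 1 * n) := by
    calc _ ≤ _ := h
      _ = (C + B) * (n.factorial * Real.exp n) := by ring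
      _ ≤ (C + B) * (Real.exp 1 * n * (n : ℝ) ^ n) := by gcongr
      _ = _ := by ring
  have h3 := le_of_mul_le_mul_left h2 hnn
  have h4 : C ≤ (C + B) * Real.exp 1 * n := by
    have : 1 ≤ Real.exp 1 * n := one_le_mul_of_one_le_of_one_le he hn'
    nlinarith
  rw [abs_le]
  constructor <;> linarith

lemma aux_const (a b : ℝ) (hb : b ≤ -1) (f : ℝ → ℝ)
    (hf : IntegrableOn f (Set.Ioo a b)) (K : ℝ) (hK0 : 0 ≤ K)
    (hK : ∀ n : ℕ, 1 ≤ n → |∫ x in Set.Ioo a b, x ^ n * f x| ≤ K * n)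
    (t : ℝ) (ht : t < -1) :
    ∫ x in Set.Ioo a b, (Set.Ioi t).indicator f x = ∫ x in Set.Ioo a b, f x := by
  have hexp : ∀ y : ℝ, HasSum (fun k : ℕ => y ^ k / k.factorial) (Real.exp y) := by
    intro y
    rw [Real.exp_eq_exp_ℝ]
    exact NormedSpace.expSeries_div_hasSum_exp y
  have ht0 : t ≠ 0 := by linarith
  have ht2 : 1 < t ^ 2 := by nlinarith
  set r := (t ^ 2)⁻¹ with hr
  have hr0 : 0 < r := by positivity
  have hr1 : r < 1 := inv_lt_one_of_one_lt₀ ht2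
  have hlim1 : Filter.Tendsto
      (fun n : ℕ => ∫ x in Set.Ioo a b, Real.exp (-(r * x ^ 2) ^ n) * f x)
      Filter.atTop (nhds (∫ x in Set.Ioo a b, (Set.Ioi t).indicator f x)) := by
    refine tendsto_integral_of_dominated_convergence (fun x => |f x|) ?_ (Integrable.abs hf) ?_ ?_
    · intro n
      exact (Continuous.aestronglyMeasurable (by fun_prop)).mul hf.1
    · intro n
      refine Filter.Eventually.of_forall fun x => ?_
      rw [Real.norm_eq_abs, abs_mul, abs_of_pos (Real.exp_pos _)]
      refine mul_le_of_le_one_left (abs_nonneg _) (Real.exp_le_one_iff.2 ?_)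
      have : 0 ≤ (r * x ^ 2) ^ n := by positivity
      linarith
    · have hne : ∀ᵐ x ∂(volume.restrict (Set.Ioo a b)), x ≠ t :=
        ae_restrict_of_ae (by simp [ae_iff])
      filter_upwards [ae_restrict_mem measurableSet_Ioo, hne] with x hx hxt
      have hx1 : x < -1 := lt_of_lt_of_le hx.2 hb
      rcases lt_or_gt_of_ne hxt with h | h
      · rw [Set.indicator_of_notMem (by simp [h.le])]
        have h1 : 1 < r * x ^ 2 := by
          rw [hr, inv_mul_eq_div, one_lt_div (by positivity)]; nlinarith
        have := (Real.tendsto_exp_neg_atTop_nhds_zero.comp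
          (tendsto_pow_atTop_atTop_of_one_lt h1)).mul_const (f x)
        simpa [Function.comp_def] using this
      · rw [Set.indicator_of_mem (by simpa using h)]
        have h1 : r * x ^ 2 < 1 := by
          rw [hr, inv_mul_eq_div, div_lt_one (by positivity)]; nlinarith
        have := ((Real.continuous_exp.tendsto _).comp
          (tendsto_pow_atTop_nhds_zero_of_lt_one (by positivity) h1).neg).mul_const (f x)
        simpa [Function.comp_def] using this
  have hbound : ∀ n : ℕ, 1 ≤ n →
      |(∫ x in Set.Ioo a b, Real.exp (-(r * x ^ 2) ^ n) * f x) - ∫ x in Set.Ioo a b, f x|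
        ≤ 2 * K * Real.exp 1 * (n * r ^ n) := by
    intro n hn
    have h1 := aux_sum a b hb f hf (fun k => (-r ^ n) ^ k / k.factorial) (fun k => 2 * n * k)
      (fun x => Real.exp (-(r * x ^ 2) ^ n))
      (by
        refine (hexp (r ^ n * |a| ^ (2 * n))).summable.congr fun k => ?_
        rw [abs_div, abs_pow, abs_neg, abs_of_pos (by positivity : 0 < r ^ n), Nat.abs_cast,
          mul_pow, ← pow_mul |a|]
        ring)
      (fun x => by
        have := hexp (-(r * x ^ 2) ^ n)
        convert this using 2 with k
        rw [pow_mul x, pow_mul x, mul_pow, ← neg_mul, mul_pow]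
        ring)
    have h2 := (hasSum_nat_add_iff' 1).2 h1
    simp only [Finset.range_one, Finset.sum_singleton, pow_zero, Nat.factorial_zero, Nat.cast_one,
      div_one, one_mul, mul_zero] at h2
    have h3 := (hexp 1).mul_left (2 * K * (n * r ^ n))
    have h4 := tsum_of_norm_bounded h3 (f := fun k : ℕ =>
      (-r ^ n) ^ (k + 1) / ((k + 1).factorial : ℝ) *
        ∫ x in Set.Ioo a b, x ^ (2 * n * (k + 1)) * f x) (fun k => by
      have hk := hK (2 * n * (k + 1)) (by have : 0 < 2 * n * (k + 1) := by positivity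
                                          omega)
      rw [Real.norm_eq_abs, abs_mul, abs_div, abs_pow, abs_neg,
        abs_of_pos (by positivity : 0 < r ^ n), Nat.abs_cast]
      have hq : (r ^ n) ^ (k + 1) ≤ r ^ n :=
        pow_le_of_le_one (by positivity) (pow_le_one₀ hr0.le hr1.le) (by omega)
      calc _ ≤ r ^ n / ((k + 1).factorial : ℝ) * (K * ((2 * n * (k + 1) : ℕ) : ℝ)) := by gcongr
        _ = _ := by
          rw [Nat.factorial_succ]; push_cast
          field_simp
          try simp)
    rw [h2.tsum_eq] at h4
    rw [Real.norm_eq_abs] at h4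
    calc _ ≤ _ := h4
      _ = _ := by ring
  have hlim2 : Filter.Tendsto
      (fun n : ℕ => ∫ x in Set.Ioo a b, Real.exp (-(r * x ^ 2) ^ n) * f x)
      Filter.atTop (nhds (∫ x in Set.Ioo a b, f x)) := by
    rw [tendsto_iff_norm_sub_tendsto_zero]
    have h0 := (tendsto_self_mul_const_pow_of_lt_one hr0.le hr1).const_mul
      (2 * K * Real.exp 1)
    rw [mul_zero] at h0
    refine squeeze_zero' (Filter.Eventually.of_forall fun _ => norm_nonneg _) ?_ h0
    filter_upwards [Filter.eventually_ge_atTop 1] with n hn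
    exact hbound n hn
  exact tendsto_nhds_unique hlim1 hlim2

lemma aux_unbdd (a b : ℝ) (hb : b ≤ -1) (f : ℝ → ℝ)
    (hf : IntegrableOn f (Set.Ioo a b))
    (hpos : ∃ u v : ℝ, a ≤ u ∧ u < v ∧ v ≤ b ∧
      ∀ᵐ x ∂(volume.restrict (Set.Ioo u v)), 0 < f x) (C : ℝ) :
    ∃ n : ℕ, C < ∫ x in Set.Ioo a b, x ^ n * f x := by
  by_contra! hcon
  obtain ⟨u, v, hau, huv, hvb, hp⟩ := hpos
  obtain ⟨K, hK0, hK⟩ := aux_poly a b hb f hf (max C 0) (le_max_right _ _)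
    (fun n => (hcon n).trans (le_max_left _ _))
  obtain ⟨p, hup, hpv⟩ := exists_between huv
  obtain ⟨q, hpq, hqv⟩ := exists_between hpv
  have e1 := aux_const a b hb f hf K hK0 hK p (by linarith)
  have e2 := aux_const a b hb f hf K hK0 hK q (by linarith)
  have hsub : Set.Ioc p q ⊆ Set.Ioo u v := fun x hx => ⟨by linarith [hx.1], by linarith [hx.2]⟩
  have hsub2 : Set.Ioc p q ⊆ Set.Ioo a b := fun x hx => ⟨by linarith [hx.1], by linarith [hx.2]⟩
  have e3 : ∫ x in Set.Ioc p q, f x = 0 := by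
    have i1 : ∀ t, IntegrableOn ((Set.Ioi t).indicator f) (Set.Ioo a b) := fun t =>
      Integrable.indicator hf measurableSet_Ioi
    have := integral_sub (i1 p) (i1 q)
    rw [e1, e2, sub_self] at this
    rw [← this]
    have h : (fun x => (Set.Ioi p).indicator f x - (Set.Ioi q).indicator f x)
        = (Set.Ioc p q).indicator f := by
      ext x
      by_cases h1 : p < x <;> by_cases h2 : q < x <;> simp [Set.indicator, h1, h2]
      all_goals (exfalso; linarith)
    rw [h, setIntegral_indicator measurableSet_Ioc, Set.inter_eq_right.2 hsub2]
  have hp' : ∀ᵐ x ∂(volume.restrict (Set.Ioc p q)), 0 < f x :=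
    ae_restrict_of_ae_restrict_of_subset hsub hp
  have h0 := (integral_eq_zero_iff_of_nonneg_ae (hp'.mono fun x hx => hx.le)
    (hf.mono_set hsub2)).1 e3
  have hF : ∀ᵐ x ∂(volume.restrict (Set.Ioc p q)), False := by
    filter_upwards [h0, hp'] with x h1 h2
    simp at h1
    linarith
  rw [Filter.eventually_false_iff_eq_bot, ae_eq_bot, Measure.restrict_eq_zero] at hF
  simp at hF
  linarith

theorem exponential_growth_of_moments (a b : ℝ) (hab : a < b) (hb : b ≤ -1) (f : ℝ → ℝ)
    (hf : IntegrableOn f (Set.Ioo a b))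
    (hpos : ∃ u v : ℝ, a ≤ u ∧ u < v ∧ v ≤ b ∧
      ∀ᵐ x ∂(volume.restrict (Set.Ioo u v)), 0 < f x) :
    ∃ m : ℝ, 1 < m ∧ ∃ c : ℝ, 0 < c ∧ ∃ n : ℕ → ℕ, StrictMono n ∧ (∀ k, 0 < n k) ∧
      ∀ k : ℕ, 1 ≤ k → c * m ^ k ≤ ∫ x in Set.Ioo a b, x ^ (n k) * f x := by
  have key : ∀ (N : ℕ) (C : ℝ), ∃ n : ℕ, N < n ∧ C ≤ ∫ x in Set.Ioo a b, x ^ n * f x := by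
    intro N C
    by_contra! h
    obtain ⟨n, hn⟩ := aux_unbdd a b hb f hf hpos
      (|C| + ∑ i ∈ Finset.range (N + 1), |∫ x in Set.Ioo a b, x ^ i * f x|)
    by_cases hN : N < n
    · have h1 := h n hN
      have h2 : 0 ≤ ∑ i ∈ Finset.range (N + 1), |∫ x in Set.Ioo a b, x ^ i * f x| :=
        Finset.sum_nonneg fun _ _ => abs_nonneg _
      linarith [le_abs_self C]
    · have h1 := Finset.single_le_sum
        (f := fun i : ℕ => |∫ x in Set.Ioo a b, x ^ i * f x|) (s := Finset.range (N + 1))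
        (fun _ _ => abs_nonneg _) (Finset.mem_range.2 (by omega : n < N + 1))
      linarith [le_abs_self (∫ x in Set.Ioo a b, x ^ n * f x), abs_nonneg C]
  choose g hg1 hg2 using key
  let n : ℕ → ℕ := fun k => Nat.rec (g 0 1) (fun j r => g r (2 ^ (j + 1))) k
  have hs : ∀ k, n (k + 1) = g (n k) (2 ^ (k + 1)) := fun k => rfl
  have hmono : StrictMono n := strictMono_nat_of_lt_succ fun k => by rw [hs]; exact hg1 _ _
  refine ⟨2, by norm_num, 1, one_pos, n, hmono, fun k => ?_, fun k hk => ?_⟩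
  · have h0 : 0 < n 0 := hg1 0 1
    exact h0.trans_le (hmono.monotone (Nat.zero_le k))
  · obtain ⟨j, rfl⟩ : ∃ j, k = j + 1 := ⟨k - 1, by omega⟩
    rw [hs, one_mul]
    exact hg2 _ _
end

section
/- Let μ be a finite real signed Borel measure on ℝ with compact support contained in (-∞,-1], and suppose μ is not supported on the singleton {-1} (i.e., the restriction of μ to ℝ \ {-1} is not the zero measure). Then sup_{n ≥ 0} ∫ xⁿ dμ = ∞ and inf_{n ≥ 0} ∫ xⁿ dμ = -∞ (the sequence of moments of μ is unbounded above and unbounded below). -/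
open MeasureTheory

/-- The integral of `f` with respect to a finite signed measure `μ`, defined via the
Jordan decomposition of `μ`. -/
noncomputable def signedIntegral (μ : SignedMeasure ℝ) (f : ℝ → ℝ) : ℝ :=
  (∫ x, f x ∂μ.toJordanDecomposition.posPart) - ∫ x, f x ∂μ.toJordanDecomposition.negPart

open Filter Topology

lemma hasSum_exp_aux (p : Measure ℝ) [IsFiniteMeasure p] (R : ℝ)
    (hR : ∀ᵐ x ∂p, |x| ≤ R) (k : ℕ) (s : ℝ) :
    HasSum (fun n : ℕ => s ^ n / (n.factorial : ℝ) * ∫ x, x ^ (k * n) ∂p)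
      (∫ x, Real.exp (s * x ^ k) ∂p) := by
  have hb : ∀ n : ℕ, ∀ᵐ x ∂p, ‖s ^ n / (n.factorial : ℝ) * x ^ (k * n)‖
      ≤ (|s| * R ^ k) ^ n / (n.factorial : ℝ) := by
    intro n
    filter_upwards [hR] with x hx
    rw [norm_mul, norm_div, norm_pow, norm_pow, Real.norm_eq_abs, Real.norm_eq_abs,
      Real.norm_eq_abs, Nat.abs_cast, mul_pow, ← pow_mul, div_mul_eq_mul_div]
    gcongr
  have hint : ∀ n : ℕ, Integrable (fun x : ℝ => s ^ n / (n.factorial : ℝ) * x ^ (k * n)) p := by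
    intro n
    exact Integrable.of_bound (by fun_prop) _ (hb n)
  have h := hasSum_integral_of_summable_integral_norm (μ := p)
    (F := fun (n : ℕ) (x : ℝ) => s ^ n / (n.factorial : ℝ) * x ^ (k * n)) hint (by
      refine Summable.of_nonneg_of_le (fun n => integral_nonneg fun x => norm_nonneg _)
        (fun n => ?_) ((Real.summable_pow_div_factorial (|s| * R ^ k)).mul_right (p.real Set.univ))
      have := integral_mono_ae (hint n).norm (integrable_const _) (hb n)
      simpa [mul_comm] using this)
  have e : ∀ x : ℝ, ∑' n : ℕ, s ^ n / (n.factorial : ℝ) * x ^ (k * n) = Real.exp (s * x ^ k) := by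
    intro x
    rw [Real.exp_eq_exp_ℝ, NormedSpace.exp_eq_tsum_div]
    refine tsum_congr fun n => ?_
    rw [mul_pow, ← pow_mul, div_mul_eq_mul_div]
  simp only [e, integral_const_mul] at h
  exact h

lemma factorial_exp_aux (n : ℕ) :
    ((n + 1).factorial : ℝ) * Real.exp ((n + 1 : ℕ) : ℝ)
      ≤ Real.exp 1 * (n + 1) * ((n + 1 : ℕ) : ℝ) ^ (n + 1) := by
  induction n with
  | zero => simp
  | succ n ih =>
    have h0 : (0:ℝ) < (n:ℝ) + 2 := by positivity
    have h1 : ((n:ℝ) + 1) / (n + 2) ≤ Real.exp (-(1 / ((n:ℝ) + 2))) := by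
      have := Real.add_one_le_exp (-(1 / ((n:ℝ) + 2)))
      refine le_trans (le_of_eq ?_) this
      field_simp
      ring
    have h2 : (((n:ℝ) + 1) / (n + 2)) ^ (n + 2) ≤ Real.exp (-1) := by
      refine (pow_le_pow_left₀ (by positivity) h1 _).trans (le_of_eq ?_)
      rw [← Real.exp_nat_mul]
      congr 1
      push_cast
      field_simp
    have h3 : Real.exp 1 * ((n:ℝ) + 1) ^ (n + 2) ≤ ((n:ℝ) + 2) ^ (n + 2) := by
      rw [div_pow, div_le_iff₀ (by positivity)] at h2
      have := mul_le_mul_of_nonneg_left h2 (Real.exp_pos 1).le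
      rwa [← mul_assoc, ← Real.exp_add, add_neg_cancel, Real.exp_zero, one_mul] at this
    rw [Nat.factorial_succ]
    push_cast at ih ⊢
    have e1 : (n:ℝ) + 1 + 1 = n + 2 := by ring
    rw [Real.exp_add, e1]
    calc ((n:ℝ) + 2) * ((n+1).factorial : ℝ) * (Real.exp (n + 1) * Real.exp 1)
        = ((n:ℝ) + 2) * Real.exp 1 * (((n+1).factorial : ℝ) * Real.exp (n + 1)) := by ring
      _ ≤ ((n:ℝ) + 2) * Real.exp 1 * (Real.exp 1 * (n + 1) * ((n:ℝ) + 1) ^ (n + 1)) := by gcongr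
      _ = ((n:ℝ) + 2) * Real.exp 1 * (Real.exp 1 * ((n:ℝ) + 1) ^ (n + 2)) := by ring
      _ ≤ ((n:ℝ) + 2) * Real.exp 1 * (((n:ℝ) + 2) ^ (n + 2)) := by gcongr
      _ = _ := by ring

lemma growth_aux (p q : Measure ℝ) [IsFiniteMeasure p] [IsFiniteMeasure q] (R : ℝ)
    (hpR : ∀ᵐ x ∂p, |x| ≤ R) (hqR : ∀ᵐ x ∂q, |x| ≤ R)
    (hq1 : ∀ᵐ x ∂q, x ≤ -1) (hp1 : ∀ᵐ x ∂p, x ≤ -1) (C : ℝ)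
    (hC : ∀ n : ℕ, (∫ x, x ^ n ∂p) - ∫ x, x ^ n ∂q ≤ C) :
    ∃ A : ℝ, ∀ n : ℕ, |(∫ x, x ^ n ∂p) - ∫ x, x ^ n ∂q| ≤ A * (n + 1) := by
  set m : ℕ → ℝ := fun n => (∫ x, x ^ n ∂p) - ∫ x, x ^ n ∂q with hm
  have hm' : ∀ n, m n ≤ C := hC
  set Q := q.real Set.univ with hQ
  have hQ0 : 0 ≤ Q := measureReal_nonneg
  have key : ∀ (t : ℝ), 0 ≤ t → ∀ n : ℕ,
      t ^ n / (n.factorial : ℝ) * (C - m n) ≤ (|C| + Q) * Real.exp t := by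
    intro t ht n
    have hp := hasSum_exp_aux p R hpR 1 t
    have hq := hasSum_exp_aux q R hqR 1 t
    have he : HasSum (fun n : ℕ => t ^ n / (n.factorial : ℝ)) (Real.exp t) := by
      rw [Real.exp_eq_exp_ℝ]
      exact NormedSpace.expSeries_div_hasSum_exp t
    have hs := (he.mul_right C).sub (hp.sub hq)
    simp only [one_mul, pow_one] at hs
    have h1 : t ^ n / (n.factorial : ℝ) * (C - m n) ≤ Real.exp t * C -
        ((∫ x, Real.exp (t * x) ∂p) - ∫ x, Real.exp (t * x) ∂q) := by
      have := le_hasSum hs n (fun j _ => by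
        have : 0 ≤ t ^ j / (j.factorial : ℝ) * (C - m j) :=
          mul_nonneg (by positivity) (sub_nonneg.2 (hm' j))
        refine this.trans (le_of_eq ?_)
        simp only [hm]; ring)
      refine le_trans (le_of_eq ?_) this
      simp only [hm]; ring
    have h2 : 0 ≤ ∫ x, Real.exp (t * x) ∂p := integral_nonneg fun x => (Real.exp_pos _).le
    have h3 : ∫ x, Real.exp (t * x) ∂q ≤ Q := by
      have hle : ∀ᵐ x ∂q, Real.exp (t * x) ≤ 1 := by
        filter_upwards [hq1] with x hx
        rw [Real.exp_le_one_iff]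
        nlinarith
      have hi : Integrable (fun x : ℝ => Real.exp (t * x)) q := by
        refine Integrable.of_bound (by fun_prop) 1 ?_
        filter_upwards [hle] with x hx
        rwa [Real.norm_eq_abs, abs_of_pos (Real.exp_pos _)]
      have := integral_mono_ae hi (integrable_const (1:ℝ)) hle
      simpa using this
    have h4 : 1 ≤ Real.exp t := Real.one_le_exp ht
    nlinarith [le_abs_self C]
  refine ⟨|C| + (|C| + Q) * Real.exp 1, fun n => ?_⟩
  have hB : 0 ≤ |C| + Q := by positivity
  have hmain : C - m n ≤ (|C| + Q) * Real.exp 1 * (n + 1) := by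
    rcases n with _ | n
    · have := key 0 le_rfl 0
      simp only [pow_zero, Nat.factorial_zero, Nat.cast_one, div_one, one_mul, Real.exp_zero,
        mul_one] at this
      have h1 : 1 ≤ Real.exp 1 := Real.one_le_exp zero_le_one
      simp only [Nat.cast_zero, zero_add, mul_one]
      nlinarith
    · have h1 := key ((n + 1 : ℕ) : ℝ) (by positivity) (n + 1)
      have h2 := factorial_exp_aux n
      have hf : (0:ℝ) < ((n+1).factorial : ℝ) := by positivity
      have hpw : (0:ℝ) < ((n + 1 : ℕ) : ℝ) ^ (n + 1) := by positivity
      rw [div_mul_eq_mul_div, div_le_iff₀ hf] at h1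
      have h3 : ((n + 1 : ℕ) : ℝ) ^ (n + 1) * (C - m (n + 1)) ≤
          ((n + 1 : ℕ) : ℝ) ^ (n + 1) * ((|C| + Q) * Real.exp 1 * (n + 1)) := by
        refine h1.trans ?_
        have := mul_le_mul_of_nonneg_left h2 hB
        refine (le_of_eq ?_).trans (this.trans (le_of_eq ?_)) <;> ring
      have h4 := le_of_mul_le_mul_left h3 hpw
      refine h4.trans ?_
      have : 0 ≤ (|C| + Q) * Real.exp 1 := by positivity
      gcongr
      push_cast
      linarith
  have hn : (0:ℝ) ≤ n := Nat.cast_nonneg n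
  have hE : 0 ≤ (|C| + Q) * Real.exp 1 := by positivity
  change |m n| ≤ _
  rw [abs_le]
  have := hm' n
  have hc := le_abs_self C
  have hc' := neg_abs_le C
  have hc0 := abs_nonneg C
  constructor <;> nlinarith [mul_nonneg hc0 hn, mul_nonneg hE hn]

lemma dct_aux (p : Measure ℝ) [IsFiniteMeasure p] (hp1 : ∀ᵐ x ∂p, x ≤ -1)
    (a : ℝ) (ha : 1 < a) (t : ℝ) (ht : 0 < t) :
    Tendsto (fun j : ℕ => ∫ x, Real.exp (-t * (a⁻¹) ^ (2 * j) * x ^ (2 * j)) ∂p) atTop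
      (𝓝 (p.real (Set.Ioi (-a)) + Real.exp (-t) * p.real {-a})) := by
  have ha0 : 0 < a := by linarith
  have hlim : ∫ x, ((Set.Ioi (-a)).indicator (fun _ => (1:ℝ)) x
      + ({-a} : Set ℝ).indicator (fun _ => Real.exp (-t)) x) ∂p
      = p.real (Set.Ioi (-a)) + Real.exp (-t) * p.real {-a} := by
    rw [integral_add, integral_indicator_const _ measurableSet_Ioi,
      integral_indicator_const _ (measurableSet_singleton _)]
    · simp [mul_comm]
    · exact (integrable_const _).indicator measurableSet_Ioi
    · exact (integrable_const _).indicator (measurableSet_singleton _)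
  rw [← hlim]
  refine tendsto_integral_of_dominated_convergence (fun _ => (1:ℝ)) (fun j => by fun_prop)
    (integrable_const _) (fun j => ?_) ?_
  · refine Eventually.of_forall fun x => ?_
    rw [Real.norm_eq_abs, abs_of_pos (Real.exp_pos _), Real.exp_le_one_iff, mul_assoc, ← mul_pow,
      pow_mul]
    have : 0 ≤ ((a⁻¹ * x) ^ 2) ^ j := by positivity
    nlinarith
  · filter_upwards [hp1] with x hx
    have hfun : (fun j : ℕ => Real.exp (-t * (a⁻¹) ^ (2 * j) * x ^ (2 * j)))
        = fun j : ℕ => Real.exp (-(t * ((x / a) ^ 2) ^ j)) := by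
      funext j
      congr 1
      rw [mul_assoc, ← mul_pow, pow_mul, div_eq_inv_mul]
      ring
    rw [hfun]
    have hsq : (x / a) ^ 2 = x ^ 2 / a ^ 2 := div_pow _ _ _
    rcases lt_trichotomy x (-a) with h | h | h
    · have h1 : 1 < (x / a) ^ 2 := by
        rw [hsq, one_lt_div (by positivity)]; nlinarith
      have hx1 : x ∉ Set.Ioi (-a) := by simp; linarith
      have hx2 : x ∉ ({-a} : Set ℝ) := by simp; linarith
      rw [Set.indicator_of_notMem hx1, Set.indicator_of_notMem hx2, add_zero]
      exact Real.tendsto_exp_neg_atTop_nhds_zero.comp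
        ((tendsto_pow_atTop_atTop_of_one_lt h1).const_mul_atTop ht)
    · have h1 : (x / a) ^ 2 = 1 := by
        rw [hsq, h, neg_sq, div_self (by positivity)]
      simp only [h1, one_pow, mul_one]
      simp [h]
    · have h1 : (x / a) ^ 2 < 1 := by
        rw [hsq, div_lt_one (by positivity)]; nlinarith
      have hx1 : x ∈ Set.Ioi (-a) := h
      have hx2 : x ∉ ({-a} : Set ℝ) := by simp; linarith
      rw [Set.indicator_of_mem hx1, Set.indicator_of_notMem hx2, add_zero]
      have h2 := ((tendsto_pow_atTop_nhds_zero_of_lt_one (by positivity) h1).const_mul t).neg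
      rw [mul_zero, neg_zero] at h2
      have := (Real.continuous_exp.tendsto 0).comp h2
      rwa [Real.exp_zero] at this

lemma limit_aux (p q : Measure ℝ) [IsFiniteMeasure p] [IsFiniteMeasure q] (R : ℝ)
    (hpR : ∀ᵐ x ∂p, |x| ≤ R) (hqR : ∀ᵐ x ∂q, |x| ≤ R) (A : ℝ)
    (hA : ∀ n : ℕ, |(∫ x, x ^ n ∂p) - ∫ x, x ^ n ∂q| ≤ A * (n + 1))
    (a : ℝ) (ha : 1 < a) (t : ℝ) :
    Tendsto (fun j : ℕ => (∫ x, Real.exp (-t * (a⁻¹) ^ (2 * j) * x ^ (2 * j)) ∂p)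
      - ∫ x, Real.exp (-t * (a⁻¹) ^ (2 * j) * x ^ (2 * j)) ∂q) atTop
      (𝓝 (p.real Set.univ - q.real Set.univ)) := by
  have ha0 : 0 < a := by linarith
  set m : ℕ → ℝ := fun n => (∫ x, x ^ n ∂p) - ∫ x, x ^ n ∂q with hm
  set b : ℕ → ℝ := fun n => (a⁻¹) ^ n * m n with hb
  have hb0 : Tendsto b atTop (𝓝 0) := by
    have hr1 : a⁻¹ < 1 := inv_lt_one_of_one_lt₀ ha
    have h1 := tendsto_self_mul_const_pow_of_lt_one (inv_pos.2 ha0).le hr1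
    have h2 := tendsto_pow_atTop_nhds_zero_of_lt_one (inv_pos.2 ha0).le hr1
    have h3 := (h1.add h2).const_mul A
    simp only [add_zero, mul_zero] at h3
    refine squeeze_zero_norm (fun n => ?_) h3
    rw [hb]
    simp only [norm_mul, norm_pow, Real.norm_eq_abs, abs_of_pos (inv_pos.2 ha0)]
    have : 0 ≤ a⁻¹ ^ n := by positivity
    have := mul_le_mul_of_nonneg_left (hA n) this
    refine this.trans (le_of_eq ?_)
    ring
  obtain ⟨B, hB⟩ := hb0.norm.bddAbove_range
  have hB' : ∀ n, |b n| ≤ B := fun n => hB ⟨n, rfl⟩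
  have hsum : ∀ j : ℕ, (∫ x, Real.exp (-t * (a⁻¹) ^ (2 * j) * x ^ (2 * j)) ∂p)
      - (∫ x, Real.exp (-t * (a⁻¹) ^ (2 * j) * x ^ (2 * j)) ∂q)
      = ∑' k : ℕ, (-t) ^ k / (k.factorial : ℝ) * b (2 * j * k) := by
    intro j
    have hs := (hasSum_exp_aux p R hpR (2 * j) (-t * (a⁻¹) ^ (2 * j))).sub
      (hasSum_exp_aux q R hqR (2 * j) (-t * (a⁻¹) ^ (2 * j)))
    rw [← hs.tsum_eq]
    refine tsum_congr fun k => ?_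
    simp only [hb, hm]
    rw [mul_pow, ← pow_mul]
    ring
  simp only [hsum]
  have hl : p.real Set.univ - q.real Set.univ
      = ∑' k : ℕ, (if k = 0 then p.real Set.univ - q.real Set.univ else 0) := by
    rw [tsum_ite_eq]
  rw [hl]
  refine tendsto_tsum_of_dominated_convergence
    (bound := fun k : ℕ => |t| ^ k / (k.factorial : ℝ) * B)
    ((Real.summable_pow_div_factorial |t|).mul_right B) (fun k => ?_) ?_
  · rcases k with _ | k
    · simp [hb, hm]
    · simp only [Nat.add_eq_zero_iff, one_ne_zero, and_false, if_false]
      have h1 : Tendsto (fun j : ℕ => 2 * j * (k + 1)) atTop atTop :=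
        tendsto_atTop_mono (fun j => by
          simp only [id]
          nlinarith [Nat.zero_le (j * k)]) tendsto_id
      have := (hb0.comp h1).const_mul ((-t) ^ (k + 1) / ((k + 1).factorial : ℝ))
      rwa [mul_zero] at this
  · refine Eventually.of_forall fun j k => ?_
    rw [norm_mul, norm_div, norm_pow, Real.norm_eq_abs, Real.norm_eq_abs, Real.norm_eq_abs,
      Nat.abs_cast, abs_neg]
    have := hB' (2 * j * k)
    gcongr

lemma main_aux (p q : Measure ℝ) [IsFiniteMeasure p] [IsFiniteMeasure q] (R : ℝ)
    (hpR : ∀ᵐ x ∂p, |x| ≤ R) (hqR : ∀ᵐ x ∂q, |x| ≤ R)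
    (hp1 : ∀ᵐ x ∂p, x ≤ -1) (hq1 : ∀ᵐ x ∂q, x ≤ -1) (hs : p.MutuallySingular q) (C : ℝ)
    (hC : ∀ n : ℕ, (∫ x, x ^ n ∂p) - ∫ x, x ^ n ∂q ≤ C) :
    p {(-1 : ℝ)}ᶜ = 0 ∧ q {(-1 : ℝ)}ᶜ = 0 := by
  obtain ⟨A, hA⟩ := growth_aux p q R hpR hqR hq1 hp1 C hC
  have hIic : ∀ b : ℝ, b < -1 → p (Set.Iic b) = q (Set.Iic b) := by
    intro b hb
    have key : ∀ t : ℝ, 0 < t → (p.real (Set.Ioi b) + Real.exp (-t) * p.real {b})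
        - (q.real (Set.Ioi b) + Real.exp (-t) * q.real {b})
        = p.real Set.univ - q.real Set.univ := by
      intro t ht
      have h1 := (dct_aux p hp1 (-b) (by linarith) t ht).sub
        (dct_aux q hq1 (-b) (by linarith) t ht)
      rw [neg_neg] at h1
      exact tendsto_nhds_unique h1 (limit_aux p q R hpR hqR A hA (-b) (by linarith) t)
    have k1 := key 1 one_pos
    have k2 := key 2 two_pos
    have hlt : Real.exp (-2) < Real.exp (-1) := Real.exp_lt_exp.2 (by norm_num)
    have hz : p.real {b} - q.real {b} = 0 := by
      have : (Real.exp (-1) - Real.exp (-2)) * (p.real {b} - q.real {b}) = 0 := by linarith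
      rcases mul_eq_zero.1 this with h | h
      · linarith
      · exact h
    have hz' : p.real {b} = q.real {b} := by linarith
    rw [hz'] at k1
    have c1 := measureReal_add_measureReal_compl (μ := p) (measurableSet_Iic (a := b))
    have c2 := measureReal_add_measureReal_compl (μ := q) (measurableSet_Iic (a := b))
    rw [Set.compl_Iic] at c1 c2
    have : p.real (Set.Iic b) = q.real (Set.Iic b) := by linarith
    exact (measureReal_eq_measureReal_iff).1 this
  have hzero : ∀ b : ℝ, b < -1 → p (Set.Iic b) = 0 ∧ q (Set.Iic b) = 0 := by
    intro b hb
    have heq : p.restrict (Set.Iic b) = q.restrict (Set.Iic b) := by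
      refine Measure.ext_of_Iic _ _ fun c => ?_
      rw [Measure.restrict_apply measurableSet_Iic, Measure.restrict_apply measurableSet_Iic,
        Set.Iic_inter_Iic]
      exact hIic _ (lt_of_le_of_lt inf_le_right hb)
    have hms : (p.restrict (Set.Iic b)).MutuallySingular (p.restrict (Set.Iic b)) := by
      have := (hs.restrict (Set.Iic b)).symm.restrict (Set.Iic b)
      rw [← heq] at this
      exact this.symm
    have h0 := (Measure.MutuallySingular.self_iff _).1 hms
    have h0' := h0
    rw [heq] at h0'
    exact ⟨Measure.restrict_eq_zero.1 h0, Measure.restrict_eq_zero.1 h0'⟩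
  have hfin : ∀ r : Measure ℝ, (∀ᵐ x ∂r, x ≤ -1) → (∀ b : ℝ, b < -1 → r (Set.Iic b) = 0) →
      r {(-1 : ℝ)}ᶜ = 0 := by
    intro r hr h
    have h1 : ∀ᵐ x ∂r, ∀ n : ℕ, x ∉ Set.Iic (-1 - 1 / ((n : ℝ) + 1)) := by
      rw [ae_all_iff]
      intro n
      refine measure_eq_zero_iff_ae_notMem.1 (h _ ?_)
      have : (0:ℝ) < 1 / ((n : ℝ) + 1) := by positivity
      linarith
    refine measure_eq_zero_iff_ae_notMem.2 ?_
    filter_upwards [hr, h1] with x hx hx1 hne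
    have hlt : x < -1 := lt_of_le_of_ne hx hne
    obtain ⟨n, hn⟩ := exists_nat_one_div_lt (show (0:ℝ) < -1 - x by linarith)
    exact hx1 n (by simp only [Set.mem_Iic]; linarith)
  exact ⟨hfin p hp1 fun b hb => (hzero b hb).1, hfin q hq1 fun b hb => (hzero b hb).2⟩

theorem moments_of_signed_measures (μ : SignedMeasure ℝ)
    (hsupp : ∃ K : Set ℝ, IsCompact K ∧ K ⊆ Set.Iic (-1 : ℝ) ∧ μ.totalVariation Kᶜ = 0)
    (hne : μ.totalVariation ({(-1 : ℝ)}ᶜ) ≠ 0) :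
    ¬ BddAbove (Set.range fun n : ℕ => signedIntegral μ (fun x => x ^ n)) ∧
    ¬ BddBelow (Set.range fun n : ℕ => signedIntegral μ (fun x => x ^ n)) := by
  obtain ⟨K, hK, hK1, hK0⟩ := hsupp
  unfold signedIntegral
  unfold SignedMeasure.totalVariation at hne hK0
  have hs := μ.toJordanDecomposition.mutuallySingular
  set p := μ.toJordanDecomposition.posPart
  set q := μ.toJordanDecomposition.negPart
  rw [Measure.add_apply] at hne hK0
  obtain ⟨hpK, hqK⟩ := add_eq_zero.1 hK0
  obtain ⟨R, hR⟩ := hK.isBounded.exists_norm_le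
  have hp : ∀ᵐ x ∂p, x ∈ K := hpK
  have hq : ∀ᵐ x ∂q, x ∈ K := hqK
  have hpR : ∀ᵐ x ∂p, |x| ≤ R := hp.mono fun x hx => hR x hx
  have hqR : ∀ᵐ x ∂q, |x| ≤ R := hq.mono fun x hx => hR x hx
  have hp1 : ∀ᵐ x ∂p, x ≤ -1 := hp.mono fun x hx => hK1 hx
  have hq1 : ∀ᵐ x ∂q, x ≤ -1 := hq.mono fun x hx => hK1 hx
  constructor
  · rintro ⟨C, hC⟩
    have := main_aux p q R hpR hqR hp1 hq1 hs C fun n => hC ⟨n, rfl⟩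
    exact hne (by rw [this.1, this.2, add_zero])
  · rintro ⟨C, hC⟩
    have := main_aux q p R hqR hpR hq1 hp1 hs.symm (-C) fun n => by
      have h : C ≤ (∫ x, x ^ n ∂p) - ∫ x, x ^ n ∂q := hC ⟨n, rfl⟩
      linarith
    exact hne (by rw [this.1, this.2, add_zero])
end

section
/- If a < -1, k is an odd positive integer, and μ is a nonzero finite real signed Borel measure with compact support contained in the open interval (a,-1), then sup_{n ≥ 0} ∫ x^{kn} dμ = ∞ and inf_{n ≥ 0} ∫ x^{kn} dμ = -∞. -/
open MeasureTheory

open Filter Topology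

lemma aux_hasSum_exp (P : Measure ℝ) [IsFiniteMeasure P] (g : ℝ → ℝ) (hg : Measurable g) (R : ℝ)
    (hR : ∀ᵐ x ∂P, |g x| ≤ R) :
    HasSum (fun n : ℕ => (∫ x, g x ^ n ∂P) / (n.factorial : ℝ)) (∫ x, Real.exp (g x) ∂P) := by
  have h : HasSum (fun n : ℕ => ∫ x, g x ^ n / (n.factorial : ℝ) ∂P) (∫ x, Real.exp (g x) ∂P) := by
    refine hasSum_integral_of_dominated_convergence
      (fun n _ => R ^ n / (n.factorial : ℝ)) (fun n => ?_) (fun n => ?_) ?_ ?_ ?_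
    · exact ((hg.pow_const n).div_const _).aestronglyMeasurable
    · filter_upwards [hR] with x hx
      rw [Real.norm_eq_abs, abs_div, abs_pow, Nat.abs_cast]
      gcongr
    · exact Eventually.of_forall fun _ => Real.summable_pow_div_factorial R
    · exact integrable_const _
    · refine Eventually.of_forall fun x => ?_
      have := NormedSpace.expSeries_div_hasSum_exp (𝔸 := ℝ) (g x)
      rwa [← Real.exp_eq_exp_ℝ] at this
  simpa only [integral_div] using h

lemma aux_step2 (P N : Measure ℝ) [IsFiniteMeasure P] [IsFiniteMeasure N] (B : ℝ)
    (hP : ∀ᵐ x ∂P, 0 ≤ x ∧ x ≤ B) (hN : ∀ᵐ x ∂N, 0 ≤ x ∧ x ≤ B) (C : ℝ)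
    (hC : ∀ n : ℕ, (∫ x, (-x) ^ n ∂P) - (∫ x, (-x) ^ n ∂N) ≤ C) :
    ∃ D : ℝ, ∀ t : ℝ, 0 ≤ t →
      |(∫ x, Real.exp (t * x) ∂P) - ∫ x, Real.exp (t * x) ∂N| ≤ D * Real.exp t := by
  have key : ∀ (Q : Measure ℝ) [IsFiniteMeasure Q], (∀ᵐ x ∂Q, 0 ≤ x ∧ x ≤ B) → ∀ t : ℝ,
      HasSum (fun n : ℕ => t ^ n / (n.factorial : ℝ) * (∫ x, (-x) ^ n ∂Q))
        (∫ x, Real.exp (t * -x) ∂Q) := by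
    intro Q _ hQ t
    have := aux_hasSum_exp Q (fun x => t * -x) (by fun_prop) (|t| * B) (by
      filter_upwards [hQ] with x hx
      rw [abs_mul, abs_neg, abs_of_nonneg hx.1]
      exact mul_le_mul_of_nonneg_left hx.2 (abs_nonneg _))
    convert this using 2 with n
    simp_rw [mul_pow]
    rw [integral_const_mul]
    ring
  have small : ∀ (Q : Measure ℝ) [IsFiniteMeasure Q], (∀ᵐ x ∂Q, 0 ≤ x ∧ x ≤ B) → ∀ t : ℝ, 0 ≤ t →
      0 ≤ ∫ x, Real.exp (t * -x) ∂Q ∧ ∫ x, Real.exp (t * -x) ∂Q ≤ Q.real Set.univ := by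
    intro Q _ hQ t ht
    refine ⟨integral_nonneg fun x => (Real.exp_pos _).le, ?_⟩
    have := norm_integral_le_of_norm_le_const (μ := Q) (f := fun x => Real.exp (t * -x)) (C := 1) (by
      filter_upwards [hQ] with x hx
      rw [Real.norm_eq_abs, abs_of_pos (Real.exp_pos _), Real.exp_le_one_iff]
      nlinarith [hx.1])
    rw [one_mul] at this
    exact (le_abs_self _).trans this
  set m : ℕ → ℝ := fun n => (∫ x, (-x) ^ n ∂P) - (∫ x, (-x) ^ n ∂N) with hm
  refine ⟨2 * |C| + N.real Set.univ, fun t ht => ?_⟩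
  have hs : ∀ t : ℝ, HasSum (fun n : ℕ => t ^ n / (n.factorial : ℝ) * m n)
      ((∫ x, Real.exp (t * -x) ∂P) - ∫ x, Real.exp (t * -x) ∂N) := by
    intro t
    have h := (key P hP t).sub (key N hN t)
    simp only [← mul_sub] at h
    exact h
  have he : HasSum (fun n : ℕ => t ^ n / (n.factorial : ℝ)) (Real.exp t) := by
    have := NormedSpace.expSeries_div_hasSum_exp (𝔸 := ℝ) t
    rwa [← Real.exp_eq_exp_ℝ] at this
  have h1 := ((he.mul_left (2 * |C|)).sub (hs t))
  have h2 := hs (-t)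
  simp only [neg_mul_neg] at h2
  have hb := h2.norm_le_of_bounded h1 (fun n => by
    have hq : 0 ≤ t ^ n / (n.factorial : ℝ) := by positivity
    have e : |(-t) ^ n / (n.factorial : ℝ)| = t ^ n / (n.factorial : ℝ) := by
      rw [abs_div, abs_pow, abs_neg, abs_of_nonneg ht, Nat.abs_cast]
    rw [Real.norm_eq_abs, abs_mul, e]
    have : |m n| ≤ 2 * |C| - m n := by
      have h3 : m n ≤ |C| := (hC n).trans (le_abs_self C)
      rw [abs_le]; constructor <;> linarith [abs_nonneg C]
    calc _ ≤ t ^ n / (n.factorial : ℝ) * (2 * |C| - m n) := mul_le_mul_of_nonneg_left this hq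
      _ = _ := by ring)
  rw [Real.norm_eq_abs] at hb
  refine hb.trans ?_
  have a1 := small P hP t ht
  have a2 := small N hN t ht
  have a3 : (1 : ℝ) ≤ Real.exp t := Real.one_le_exp ht
  have a4 : 0 ≤ N.real Set.univ := measureReal_nonneg
  nlinarith

/-- the limit profile -/
noncomputable def auxProf (s u : ℝ) : ℝ :=
  if u < s then 1 else if u = s then Real.exp (-1) else 0

lemma auxProf_meas (s : ℝ) : Measurable (auxProf s) := by
  unfold auxProf
  exact Measurable.ite measurableSet_Iio measurable_const
    (Measurable.ite (measurableSet_singleton s) measurable_const measurable_const)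

lemma auxProf_bound (s u : ℝ) : ‖auxProf s u‖ ≤ 1 := by
  unfold auxProf
  split_ifs
  · simp
  · rw [Real.norm_eq_abs, abs_of_pos (Real.exp_pos _)]; simp
  · simp

lemma aux_lim_prof (Q : Measure ℝ) [IsFiniteMeasure Q] (s : ℝ) :
    Tendsto (fun j : ℕ => ∫ u, Real.exp (-Real.exp ((j : ℝ) * (u - s))) ∂Q) atTop
      (𝓝 (∫ u, auxProf s u ∂Q)) := by
  refine tendsto_integral_of_dominated_convergence (fun _ => 1) (fun n => ?_)
    (integrable_const _) (fun n => ?_) ?_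
  · exact Measurable.aestronglyMeasurable (by fun_prop)
  · refine Eventually.of_forall fun u => ?_
    rw [Real.norm_eq_abs, abs_of_pos (Real.exp_pos _), Real.exp_le_one_iff]
    linarith [Real.exp_pos ((n : ℝ) * (u - s))]
  · refine Eventually.of_forall fun u => ?_
    unfold auxProf
    split_ifs with h1 h2
    · have : Tendsto (fun j : ℕ => (j : ℝ) * (u - s)) atTop atBot :=
        tendsto_natCast_atTop_atTop.atTop_mul_const_of_neg (by linarith)
      have h3 := (Real.tendsto_exp_atBot.comp this).neg
      have h4 := (Real.continuous_exp.tendsto _).comp h3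
      simpa [Function.comp_def] using h4
    · subst h2; simp
    · have : Tendsto (fun j : ℕ => (j : ℝ) * (u - s)) atTop atTop :=
        tendsto_natCast_atTop_atTop.atTop_mul_const
          (by rcases lt_or_eq_of_le (not_lt.mp h1) with h | h
              · linarith
              · exact absurd h.symm h2)
      exact Real.tendsto_exp_atBot.comp (tendsto_neg_atTop_atBot.comp
        (Real.tendsto_exp_atTop.comp this))

lemma aux_step3 (P N : Measure ℝ) [IsFiniteMeasure P] [IsFiniteMeasure N] (B : ℝ)
    (hP : ∀ᵐ x ∂P, 0 ≤ x ∧ x ≤ B) (hN : ∀ᵐ x ∂N, 0 ≤ x ∧ x ≤ B) (D : ℝ)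
    (hD : ∀ t : ℝ, 0 ≤ t →
      |(∫ x, Real.exp (t * x) ∂P) - ∫ x, Real.exp (t * x) ∂N| ≤ D * Real.exp t)
    (s : ℝ) (hs : 1 < s) :
    (∫ u, auxProf s u ∂P) - (∫ u, auxProf s u ∂N) = P.real Set.univ - N.real Set.univ := by
  have key : ∀ (Q : Measure ℝ) [IsFiniteMeasure Q], (∀ᵐ x ∂Q, 0 ≤ x ∧ x ≤ B) → ∀ t : ℝ, 0 ≤ t →
      HasSum (fun n : ℕ => (-Real.exp (-(t * s))) ^ n / (n.factorial : ℝ) *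
        (∫ x, Real.exp ((n * t) * x) ∂Q)) (∫ x, Real.exp (-Real.exp (t * (x - s))) ∂Q) := by
    intro Q _ hQ t ht
    have := aux_hasSum_exp Q (fun x => -Real.exp (t * (x - s))) (by fun_prop)
      (Real.exp (t * (B - s))) (by
      filter_upwards [hQ] with x hx
      rw [abs_neg, abs_of_pos (Real.exp_pos _), Real.exp_le_exp]
      exact mul_le_mul_of_nonneg_left (by linarith [hx.2]) ht)
    convert this using 2 with n
    have : ∀ x, (-Real.exp (t * (x - s))) ^ n
        = (-Real.exp (-(t * s))) ^ n * Real.exp ((n * t) * x) := by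
      intro x
      rw [mul_assoc, Real.exp_nat_mul, ← mul_pow, neg_mul, ← Real.exp_add]
      ring_nf
    simp_rw [this]
    rw [integral_const_mul]
    ring
  have hbound : ∀ t : ℝ, 0 ≤ t →
      |((∫ x, Real.exp (-Real.exp (t * (x - s))) ∂P) - ∫ x, Real.exp (-Real.exp (t * (x - s))) ∂N)
        - (P.real Set.univ - N.real Set.univ)| ≤ D * (Real.exp (Real.exp (-(t * (s - 1)))) - 1) := by
    intro t ht
    have h := (key P hP t ht).sub (key N hN t ht)
    have h' := (hasSum_nat_add_iff' 1).mpr h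
    have he : HasSum (fun n : ℕ => (Real.exp (-(t * (s - 1)))) ^ n / (n.factorial : ℝ))
        (Real.exp (Real.exp (-(t * (s - 1))))) := by
      have := NormedSpace.expSeries_div_hasSum_exp (𝔸 := ℝ) (Real.exp (-(t * (s - 1))))
      rwa [← Real.exp_eq_exp_ℝ] at this
    have he' := ((hasSum_nat_add_iff' 1).mpr he).mul_left D
    have hb := h'.norm_le_of_bounded he' (fun n => by
      rw [← mul_sub, Real.norm_eq_abs, abs_mul, abs_div, abs_pow, abs_neg,
        abs_of_pos (Real.exp_pos _), Nat.abs_cast]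
      calc _ ≤ Real.exp (-(t * s)) ^ (n + 1) / ((n + 1).factorial : ℝ) *
            (D * Real.exp (((n + 1 : ℕ) : ℝ) * t)) :=
            mul_le_mul_of_nonneg_left (hD _ (by positivity)) (by positivity)
        _ = _ := by
            rw [Real.exp_nat_mul]
            have : Real.exp (-(t * (s - 1))) = Real.exp (-(t * s)) * Real.exp t := by
              rw [← Real.exp_add]; ring_nf
            rw [this, mul_pow]; ring)
    simpa [Measure.real] using hb
  have hlim := ((aux_lim_prof P s).sub (aux_lim_prof N s)).sub_const
    (P.real Set.univ - N.real Set.univ)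
  have hz : Tendsto (fun j : ℕ => D * (Real.exp (Real.exp (-((j : ℝ) * (s - 1)))) - 1)) atTop
      (𝓝 0) := by
    have h1 : Tendsto (fun j : ℕ => (j : ℝ) * (s - 1)) atTop atTop :=
      tendsto_natCast_atTop_atTop.atTop_mul_const (by linarith)
    have h2 := Real.tendsto_exp_atBot.comp (tendsto_neg_atTop_atBot.comp h1)
    have h3 := (((Real.continuous_exp.tendsto _).comp h2).sub_const 1).const_mul D
    simpa [Function.comp_def] using h3
  have h0 := squeeze_zero_norm (fun j : ℕ => by
    rw [Real.norm_eq_abs]; exact hbound j (Nat.cast_nonneg j)) hz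
  have := tendsto_nhds_unique hlim h0
  linarith

lemma aux_lim_Iic (Q : Measure ℝ) [IsFiniteMeasure Q] (s : ℝ) :
    Tendsto (fun j : ℕ => ∫ u, auxProf (s + 1 / ((j : ℝ) + 1)) u ∂Q) atTop
      (𝓝 (Q.real (Set.Iic s))) := by
  rw [← integral_indicator_one measurableSet_Iic]
  refine tendsto_integral_of_dominated_convergence (fun _ => 1)
    (fun n => (auxProf_meas _).aestronglyMeasurable)
    (integrable_const _) (fun n => Eventually.of_forall fun u => auxProf_bound _ _) ?_
  refine Eventually.of_forall fun u => ?_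
  by_cases h : u ≤ s
  · rw [Set.indicator_of_mem (by exact h)]
    refine tendsto_const_nhds.congr fun j => ?_
    have : (0 : ℝ) < 1 / ((j : ℝ) + 1) := by positivity
    simp only [auxProf, Pi.one_apply]
    rw [if_pos (by linarith)]
  · rw [Set.indicator_of_notMem (by exact h)]
    have h1 : Tendsto (fun j : ℕ => s + 1 / ((j : ℝ) + 1)) atTop (𝓝 (s + 0)) :=
      tendsto_one_div_add_atTop_nhds_zero_nat.const_add s
    rw [add_zero] at h1
    refine tendsto_const_nhds.congr' ?_
    filter_upwards [h1.eventually_lt_const (not_le.mp h)] with j hj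
    simp only [auxProf]
    rw [if_neg (by linarith), if_neg (by linarith)]

lemma aux_core (P N : Measure ℝ) [IsFiniteMeasure P] [IsFiniteMeasure N] (B d : ℝ) (hd : 1 < d)
    (hP : ∀ᵐ x ∂P, d ≤ x ∧ x ≤ B) (hN : ∀ᵐ x ∂N, d ≤ x ∧ x ≤ B) (C : ℝ)
    (hC : ∀ n : ℕ, (∫ x, (-x) ^ n ∂P) - (∫ x, (-x) ^ n ∂N) ≤ C) : P = N := by
  have hP0 : ∀ᵐ x ∂P, 0 ≤ x ∧ x ≤ B := by
    filter_upwards [hP] with x hx using ⟨by linarith [hx.1], hx.2⟩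
  have hN0 : ∀ᵐ x ∂N, 0 ≤ x ∧ x ≤ B := by
    filter_upwards [hN] with x hx using ⟨by linarith [hx.1], hx.2⟩
  obtain ⟨D, hD⟩ := aux_step2 P N B hP0 hN0 C hC
  have h3 := aux_step3 P N B hP0 hN0 D hD
  have zero : ∀ (Q : Measure ℝ), (∀ᵐ x ∂Q, d ≤ x ∧ x ≤ B) → ∀ s < d,
      ∫ u, auxProf s u ∂Q = 0 := by
    intro Q hQ s hs
    refine integral_eq_zero_of_ae ?_
    filter_upwards [hQ] with x hx
    simp only [auxProf, Pi.zero_apply]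
    rw [if_neg (by linarith [hx.1]), if_neg (by linarith [hx.1])]
  have hmass : P.real Set.univ - N.real Set.univ = 0 := by
    rw [← h3 ((1 + d) / 2) (by linarith), zero P hP _ (by linarith), zero N hN _ (by linarith),
      sub_zero]
  have heq : ∀ s, ∫ u, auxProf s u ∂P = ∫ u, auxProf s u ∂N := by
    intro s
    rcases lt_or_ge s d with h | h
    · rw [zero P hP s h, zero N hN s h]
    · have := h3 s (by linarith)
      linarith
  refine Measure.ext_of_Iic P N fun s => ?_
  have h1 := aux_lim_Iic P s
  simp_rw [heq] at h1
  have := tendsto_nhds_unique h1 (aux_lim_Iic N s)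
  exact (measureReal_eq_measureReal_iff).mp this

lemma aux_main (k : ℕ) (hodd : Odd k) (P N : Measure ℝ) [IsFiniteMeasure P]
    [IsFiniteMeasure N] (K : Set ℝ) (hK : IsCompact K) (hK1 : ∀ x ∈ K, x < -1)
    (hP : P Kᶜ = 0) (hN : N Kᶜ = 0) (C : ℝ)
    (hC : ∀ n : ℕ, (∫ x, x ^ (k * n) ∂P) - (∫ x, x ^ (k * n) ∂N) ≤ C) : P = N := by
  have hmono : StrictMono (fun x : ℝ => x ^ k) := hodd.strictMono_pow
  set f : ℝ → ℝ := fun x => -x ^ k with hf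
  have hfc : Continuous f := by fun_prop
  have hinj : Function.Injective f := fun x y h => hmono.injective (neg_injective h)
  have hemb : MeasurableEmbedding f := hfc.measurableEmbedding hinj
  have hb : ∃ d B : ℝ, 1 < d ∧ ∀ x ∈ K, d ≤ f x ∧ f x ≤ B := by
    rcases K.eq_empty_or_nonempty with h | h
    · exact ⟨2, 2, by norm_num, by simp [h]⟩
    · obtain ⟨x0, hx0, h0⟩ := hK.exists_isMinOn h hfc.continuousOn
      obtain ⟨x1, hx1, h1⟩ := hK.exists_isMaxOn h hfc.continuousOn
      refine ⟨f x0, f x1, ?_, fun x hx => ⟨h0 hx, h1 hx⟩⟩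
      have := hmono (hK1 x0 hx0)
      simp only [hodd.neg_one_pow] at this
      simp only [hf]; linarith
  obtain ⟨d, B, hd, hdB⟩ := hb
  have hae : ∀ Q : Measure ℝ, Q Kᶜ = 0 → ∀ᵐ y ∂(Q.map f), d ≤ y ∧ y ≤ B := by
    intro Q hQ
    rw [hemb.ae_map_iff]
    have : ∀ᵐ x ∂Q, x ∈ K := hQ
    filter_upwards [this] with x hx using hdB x hx
  have hmap : P.map f = N.map f := by
    refine aux_core _ _ B d hd (hae P hP) (hae N hN) C fun n => ?_
    rw [hemb.integral_map, hemb.integral_map]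
    simpa [hf, ← pow_mul] using hC n
  rw [← hemb.comap_map P, ← hemb.comap_map N, hmap]

theorem subsequence_of_moments (a : ℝ) (ha : a < -1) (k : ℕ) (hk : 0 < k) (hodd : Odd k)
    (μ : SignedMeasure ℝ) (hμ : μ ≠ 0)
    (hsupp : ∃ K : Set ℝ, IsCompact K ∧ K ⊆ Set.Ioo a (-1 : ℝ) ∧ μ.totalVariation Kᶜ = 0) :
    ¬ BddAbove (Set.range fun n : ℕ => signedIntegral μ (fun x => x ^ (k * n))) ∧
    ¬ BddBelow (Set.range fun n : ℕ => signedIntegral μ (fun x => x ^ (k * n))) := by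
  obtain ⟨K, hK, hKa, htv⟩ := hsupp
  have hne : μ.toJordanDecomposition.posPart ≠ μ.toJordanDecomposition.negPart := by
    intro h
    apply hμ
    rw [← μ.toSignedMeasure_toJordanDecomposition, JordanDecomposition.toSignedMeasure]
    simp [h]
  simp only [SignedMeasure.totalVariation, Measure.add_apply, add_eq_zero] at htv
  have hK1 : ∀ x ∈ K, x < -1 := fun x hx => (hKa hx).2
  constructor
  · rintro ⟨C, hC⟩
    exact hne (aux_main k hodd _ _ K hK hK1 htv.1 htv.2 C fun n => hC ⟨n, rfl⟩)
  · rintro ⟨C, hC⟩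
    refine hne (aux_main k hodd _ _ K hK hK1 htv.2 htv.1 (-C) fun n => ?_).symm
    have : C ≤ signedIntegral μ (fun x => x ^ (k * n)) := hC ⟨n, rfl⟩
    simp only [signedIntegral] at this
    linarith
end

section
/- Let μ be a finite positive Borel measure on ℝ with compact support satisfying μ([-1,∞)) = 0, and let M_x be the operator of multiplication by x on the real Hilbert space L²_ℝ(μ). Then g ∈ L²_ℝ(μ) is a convex-cyclic vector for M_x (i.e., the convex hull of {xⁿ·g : n ≥ 0} is dense in L²_ℝ(μ)) if and only if |g| > 0 μ-almost everywhere. -/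
open MeasureTheory

theorem aux_swap (μ : Measure ℝ) (R : ℝ) (h : ℝ → ℝ) (hh : Integrable h μ)
    (hR : ∀ᵐ x ∂μ, |x| ≤ R) (a : ℕ → ℝ) (e : ℕ → ℕ)
    (ha : Summable fun k => |a k| * R ^ (e k)) (φ : ℝ → ℝ)
    (hφ : ∀ x, HasSum (fun k => a k * x ^ (e k)) (φ x)) :
    HasSum (fun k => a k * ∫ x, x ^ (e k) * h x ∂μ) (∫ x, φ x * h x ∂μ) := by
  have hint : ∀ n : ℕ, Integrable (fun x => x ^ n * h x) μ := by
    intro n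
    refine hh.bdd_mul (c := R ^ n) (by fun_prop) ?_
    filter_upwards [hR] with x hx
    rw [norm_pow]
    exact pow_le_pow_left₀ (norm_nonneg _) hx n
  have key := hasSum_integral_of_summable_integral_norm (μ := μ)
    (F := fun k x => a k * (x ^ (e k) * h x)) (fun k => (hint _).const_mul _) ?_
  · have h1 : (fun x => ∑' k, a k * (x ^ (e k) * h x)) = fun x => φ x * h x := by
      funext x
      have := (hφ x).mul_right (h x)
      rw [← this.tsum_eq]
      simp only [mul_assoc]
    rw [h1] at key
    simpa only [integral_const_mul] using key
  · refine Summable.of_nonneg_of_le (fun k => integral_nonneg fun x => norm_nonneg _) ?_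
      (ha.mul_right (∫ x, ‖h x‖ ∂μ))
    intro k
    rw [← integral_const_mul]
    refine integral_mono_ae ((hint _).const_mul _).norm (hh.norm.const_mul _) ?_
    filter_upwards [hR] with x hx
    simp only [norm_mul, norm_pow, Real.norm_eq_abs, ← mul_assoc]
    gcongr

theorem aux_stirling (n : ℕ) : (n.factorial : ℝ) * Real.exp n ≤ 3 * (n + 1) * (n : ℝ) ^ n := by
  rcases n with _ | n
  · norm_num
  · have h1 : Stirling.stirlingSeq (n + 1) ≤ Stirling.stirlingSeq 1 :=
      Stirling.stirlingSeq'_antitone (Nat.zero_le n)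
    rw [Stirling.stirlingSeq_one, Stirling.stirlingSeq] at h1
    have hm : (0 : ℝ) < ((n + 1 : ℕ) : ℝ) := by positivity
    generalize hmm : n + 1 = m at *
    rw [div_le_div_iff₀ (by positivity) (by positivity), Real.sqrt_mul (by norm_num), div_pow,
      ← Real.exp_nat_mul, mul_one] at h1
    have h2 : (0 : ℝ) < √2 := by positivity
    have h3 : (m.factorial : ℝ) ≤ Real.exp 1 * (√m * ((m : ℝ) ^ m / Real.exp m)) := by
      refine le_of_mul_le_mul_right (h1.trans_eq ?_) h2
      ring
    have h4 : √(m : ℝ) ≤ m + 1 := by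
      rw [Real.sqrt_le_left (by positivity)]
      nlinarith
    have h5 : Real.exp 1 ≤ 3 := by linarith [Real.exp_one_lt_d9]
    calc (m.factorial : ℝ) * Real.exp m
        ≤ (Real.exp 1 * (√m * ((m : ℝ) ^ m / Real.exp m))) * Real.exp m := by gcongr
      _ = Real.exp 1 * √m * (m : ℝ) ^ m := by
          field_simp
      _ ≤ 3 * (m + 1) * (m : ℝ) ^ m := by gcongr

theorem aux_growth (μ : Measure ℝ) (R : ℝ) (h : ℝ → ℝ) (hh : Integrable h μ)
    (hR : ∀ᵐ x ∂μ, |x| ≤ R) (hneg : ∀ᵐ x ∂μ, x < -1) (c : ℝ)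
    (hc : ∀ n : ℕ, ∫ x, x ^ n * h x ∂μ ≤ c) :
    ∃ C : ℝ, 0 ≤ C ∧ ∀ n : ℕ, |∫ x, x ^ n * h x ∂μ| ≤ C * (n + 1) := by
  set b : ℕ → ℝ := fun n => ∫ x, x ^ n * h x ∂μ with hb
  set I := ∫ x, ‖h x‖ ∂μ with hI
  have hI0 : 0 ≤ I := integral_nonneg fun x => norm_nonneg _
  have hd : ∀ n : ℕ, c - b n ≤ (|c| + I) * (3 * (n + 1)) := by
    intro n
    have hs : (0 : ℝ) ≤ n := Nat.cast_nonneg n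
    have hexp : ∀ z : ℝ, HasSum (fun k : ℕ => z ^ k / (k.factorial : ℝ)) (Real.exp z) := by
      intro z
      rw [Real.exp_eq_exp_ℝ]
      exact NormedSpace.expSeries_div_hasSum_exp z
    have h1 := aux_swap μ R h hh hR (fun k => (n : ℝ) ^ k / (k.factorial : ℝ)) (fun k => k) (by
      refine (hexp (n * R)).summable.congr fun k => ?_
      rw [abs_of_nonneg (by positivity), mul_pow]
      ring) (fun x => Real.exp (n * x)) (by
      intro x
      convert hexp (n * x) using 2 with k
      rw [mul_pow]
      ring)
    have h2 := ((hexp n).mul_right c).sub h1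
    have h3 : (n : ℝ) ^ n / (n.factorial : ℝ) * c - (n : ℝ) ^ n / (n.factorial : ℝ) * b n ≤ _ :=
      le_hasSum h2 n (fun j _ => by
        rw [← mul_sub]
        exact mul_nonneg (by positivity) (sub_nonneg.2 (hc j)))
    have h4 : |∫ x, Real.exp (n * x) * h x ∂μ| ≤ I := by
      rw [← Real.norm_eq_abs, hI]
      refine norm_integral_le_of_norm_le hh.norm ?_
      filter_upwards [hneg] with x hx
      rw [norm_mul, Real.norm_eq_abs, Real.abs_exp]
      refine mul_le_of_le_one_left (norm_nonneg _) ?_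
      rw [Real.exp_le_one_iff]
      nlinarith
    have h5 := (abs_le.1 h4).1
    have h6 : (n : ℝ) ^ n / (n.factorial : ℝ) * (c - b n) ≤ (|c| + I) * Real.exp n := by
      have : 1 ≤ Real.exp n := Real.one_le_exp hs
      nlinarith [le_abs_self c, mul_le_mul_of_nonneg_left (le_abs_self c) (Real.exp_pos n).le]
    have hnn : (0 : ℝ) < (n : ℝ) ^ n := by
      rcases n with _ | n
      · simp
      · positivity
    have hf : (0 : ℝ) < (n.factorial : ℝ) := by positivity
    have h7 := aux_stirling n
    rw [div_mul_eq_mul_div, div_le_iff₀ hf] at h6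
    have h8 : (|c| + I) * (n.factorial * Real.exp n) ≤ (|c| + I) * (3 * (n + 1) * (n : ℝ) ^ n) := by
      gcongr
    refine le_of_mul_le_mul_left ?_ hnn
    calc (n : ℝ) ^ n * (c - b n) ≤ _ := h6
      _ = (|c| + I) * (n.factorial * Real.exp n) := by ring
      _ ≤ _ := h8
      _ = _ := by ring
  refine ⟨|c| + (|c| + I) * 3, by positivity, fun n => ?_⟩
  have h1 := hd n
  have h2 := hc n
  have hn : (0 : ℝ) ≤ n := Nat.cast_nonneg n
  have h3 : 0 ≤ |c| * n := by positivity
  have h4 : 0 ≤ (|c| + I) * 3 * (n + 1) := by positivity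
  change |b n| ≤ _
  change b n ≤ c at h2
  rw [abs_le]
  constructor <;> nlinarith [le_abs_self c, neg_abs_le c]

theorem aux_limit (μ : Measure ℝ) (R : ℝ) (h : ℝ → ℝ) (hh : Integrable h μ)
    (hR : ∀ᵐ x ∂μ, |x| ≤ R) (C : ℝ) (hC0 : 0 ≤ C)
    (hC : ∀ n : ℕ, |∫ x, x ^ n * h x ∂μ| ≤ C * (n + 1)) (y : ℝ) (hy : 1 < y) (l : ℝ) (hl : 0 < l) :
    Filter.Tendsto (fun N : ℕ => ∫ x, Real.exp (-l * (x / y) ^ (2 * N)) * h x ∂μ) Filter.atTop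
      (nhds (∫ x, h x ∂μ)) := by
  have hexp : ∀ z : ℝ, HasSum (fun k : ℕ => z ^ k / (k.factorial : ℝ)) (Real.exp z) := by
    intro z
    rw [Real.exp_eq_exp_ℝ]
    exact NormedSpace.expSeries_div_hasSum_exp z
  set ρ := (1 + y) / 2 with hρ
  have hρ1 : 1 < ρ := by linarith
  have hρy : ρ < y := by linarith
  set D := C * (1 + 1 / (ρ - 1)) with hD
  have hD' : ∀ n : ℕ, |∫ x, x ^ n * h x ∂μ| ≤ D * ρ ^ n := by
    intro n
    refine (hC n).trans ?_
    rw [hD, mul_assoc]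
    refine mul_le_mul_of_nonneg_left ?_ hC0
    have h1 := one_add_mul_le_pow (a := ρ - 1) (by linarith) n
    rw [add_sub_cancel] at h1
    have h2 : (n : ℝ) ≤ 1 / (ρ - 1) * ρ ^ n := by
      rw [div_mul_eq_mul_div, le_div_iff₀ (by linarith)]
      linarith
    have h3 : 1 ≤ ρ ^ n := one_le_pow₀ hρ1.le
    linarith
  have hbound : ∀ N : ℕ, ‖(∫ x, Real.exp (-l * (x / y) ^ (2 * N)) * h x ∂μ) - ∫ x, h x ∂μ‖ ≤
      D * (Real.exp (l * (ρ / y) ^ (2 * N)) - 1) := by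
    intro N
    have h1 := aux_swap μ R h hh hR (fun k => (-l / y ^ (2 * N)) ^ k / (k.factorial : ℝ))
      (fun k => 2 * N * k) (by
      refine (hexp (l / y ^ (2 * N) * R ^ (2 * N))).summable.congr fun k => ?_
      rw [abs_div, abs_pow, abs_div, abs_neg, abs_of_pos hl, abs_of_pos (by positivity : 0 < y ^ (2 * N)),
        Nat.abs_cast, mul_pow, pow_mul R (2 * N) k]
      ring) (fun x => Real.exp (-l * (x / y) ^ (2 * N))) (by
      intro x
      convert hexp (-l * (x / y) ^ (2 * N)) using 2 with k
      rw [pow_mul x (2 * N) k, div_pow x y, mul_div_assoc', div_pow (-l * _), div_pow (-l), mul_pow (-l)]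
      ring)
    have h2 := (hasSum_nat_add_iff' 1).2 h1
    have h3 := ((hasSum_nat_add_iff' 1).2 (hexp (l * (ρ / y) ^ (2 * N)))).mul_left D
    simp only [Finset.sum_range_one, pow_zero, Nat.factorial_zero, Nat.cast_one, div_one, mul_zero,
      one_mul] at h2 h3
    rw [← h2.tsum_eq]
    refine tsum_of_norm_bounded h3 fun k => ?_
    rw [norm_mul, Real.norm_eq_abs, Real.norm_eq_abs, abs_div, abs_pow, abs_div, abs_neg,
      abs_of_pos hl, abs_of_pos (by positivity : 0 < y ^ (2 * N)), Nat.abs_cast]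
    refine (mul_le_mul_of_nonneg_left (hD' _) (by positivity)).trans_eq ?_
    rw [pow_mul ρ (2 * N) (k + 1), div_pow ρ y, mul_div_assoc', div_pow, div_pow, mul_pow]
    ring
  rw [tendsto_iff_norm_sub_tendsto_zero]
  refine squeeze_zero (fun _ => norm_nonneg _) hbound ?_
  have h1 : Filter.Tendsto (fun N : ℕ => (ρ / y) ^ (2 * N)) Filter.atTop (nhds 0) :=
    (tendsto_pow_atTop_nhds_zero_of_lt_one (by positivity) (by rw [div_lt_one] <;> linarith)).comp
      (Filter.tendsto_id.const_mul_atTop' (by norm_num : 0 < 2))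
  have h2 := ((Real.continuous_exp.tendsto _).comp (h1.const_mul l)).sub_const 1 |>.const_mul D
  simpa using h2

theorem aux_tail (μ : Measure ℝ) (R : ℝ) (h : ℝ → ℝ) (hh : Integrable h μ)
    (hR : ∀ᵐ x ∂μ, |x| ≤ R) (hneg : ∀ᵐ x ∂μ, x < -1) (C : ℝ) (hC0 : 0 ≤ C)
    (hC : ∀ n : ℕ, |∫ x, x ^ n * h x ∂μ| ≤ C * (n + 1)) (y : ℝ) (hy : 1 < y) :
    ∫ x in Set.Iio (-y), h x ∂μ = 0 := by
  have key : ∀ l : ℝ, 0 < l → (∫ x in Set.Iio (-y), h x ∂μ)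
      + (1 - Real.exp (-l)) * ∫ x in {-y}, h x ∂μ = 0 := by
    intro l hl
    have h1 := aux_limit μ R h hh hR C hC0 hC y hy l hl
    have h2 : Filter.Tendsto (fun N : ℕ => ∫ x, Real.exp (-l * (x / y) ^ (2 * N)) * h x ∂μ)
        Filter.atTop (nhds (∫ x, (h x - (Set.Iio (-y)).indicator h x
          - (1 - Real.exp (-l)) * ({-y} : Set ℝ).indicator h x) ∂μ)) := by
      refine tendsto_integral_of_dominated_convergence (fun x => ‖h x‖) ?_ hh.norm ?_ ?_
      · intro N
        exact (by fun_prop : AEStronglyMeasurable (fun x => Real.exp (-l * (x / y) ^ (2 * N))) μ).mul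
          hh.aestronglyMeasurable
      · intro N
        refine Filter.Eventually.of_forall fun x => ?_
        rw [norm_mul, Real.norm_eq_abs, Real.abs_exp]
        refine mul_le_of_le_one_left (norm_nonneg _) ?_
        rw [Real.exp_le_one_iff, pow_mul]
        have : 0 ≤ ((x / y) ^ 2) ^ N := by positivity
        nlinarith
      · filter_upwards [hneg] with x hx
        have hy0 : 0 < y := by linarith
        rcases lt_trichotomy x (-y) with hxy | hxy | hxy
        · have e1 : h x - (Set.Iio (-y)).indicator h x
            - (1 - Real.exp (-l)) * ({-y} : Set ℝ).indicator h x = 0 * h x := by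
            simp [hxy, hxy.ne]
          rw [e1]
          refine Filter.Tendsto.mul_const _ ?_
          refine Real.tendsto_exp_atBot.comp ?_
          have : 1 < (x / y) ^ 2 := by
            rw [div_pow, one_lt_div (by positivity)]
            nlinarith
          simp only [pow_mul]
          exact (tendsto_pow_atTop_atTop_of_one_lt this).const_mul_atTop_of_neg (by linarith)
        · have e1 : h x - (Set.Iio (-y)).indicator h x
            - (1 - Real.exp (-l)) * ({-y} : Set ℝ).indicator h x = Real.exp (-l) * h x := by
            subst hxy
            simp
            ring
          rw [e1]
          have : (x / y) ^ 2 = 1 := by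
            rw [hxy]
            field_simp
          simp only [pow_mul, this, one_pow, mul_one]
          exact tendsto_const_nhds
        · have e1 : h x - (Set.Iio (-y)).indicator h x
            - (1 - Real.exp (-l)) * ({-y} : Set ℝ).indicator h x = Real.exp (-l * 0) * h x := by
            simp [hxy.le, hxy.ne']
          rw [e1]
          refine Filter.Tendsto.mul_const _ ?_
          refine (Real.continuous_exp.tendsto _).comp (Filter.Tendsto.const_mul _ ?_)
          have : (x / y) ^ 2 < 1 := by
            rw [div_pow, div_lt_one (by positivity)]
            nlinarith
          simp only [pow_mul]
          exact tendsto_pow_atTop_nhds_zero_of_lt_one (by positivity) this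
    have h3 := tendsto_nhds_unique h1 h2
    have i1 : Integrable ((Set.Iio (-y)).indicator h) μ := hh.indicator measurableSet_Iio
    have i2 : Integrable (({-y} : Set ℝ).indicator h) μ := hh.indicator (measurableSet_singleton _)
    have i3 : Integrable (fun x => h x - (Set.Iio (-y)).indicator h x) μ := hh.sub i1
    rw [integral_sub i3 (i2.const_mul _), integral_sub hh i1, integral_const_mul,
      integral_indicator measurableSet_Iio, integral_indicator (measurableSet_singleton _)] at h3
    linarith
  have k1 := key 1 one_pos
  have k2 := key 2 two_pos
  have hne : Real.exp (-1) - Real.exp (-2) ≠ 0 := by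
    have : Real.exp (-2) < Real.exp (-1) := Real.exp_lt_exp.2 (by norm_num)
    linarith
  have hB : ∫ x in {-y}, h x ∂μ = 0 := by
    have : (Real.exp (-1) - Real.exp (-2)) * ∫ x in {-y}, h x ∂μ = 0 := by linarith
    exact (mul_eq_zero.1 this).resolve_left hne
  rw [hB] at k1
  linarith

theorem aux_zero (μ : Measure ℝ) [IsFiniteMeasure μ] (R : ℝ) (h : ℝ → ℝ) (hh : Integrable h μ)
    (hR : ∀ᵐ x ∂μ, |x| ≤ R) (hneg : ∀ᵐ x ∂μ, x < -1) (c : ℝ)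
    (hc : ∀ n : ℕ, ∫ x, x ^ n * h x ∂μ ≤ c) : h =ᵐ[μ] 0 := by
  obtain ⟨C, hC0, hC⟩ := aux_growth μ R h hh hR hneg c hc
  have ht := aux_tail μ R h hh hR hneg C hC0 hC
  have h1 : ∫ x in Set.Iio (-1), h x ∂μ = 0 := by
    have hU : (⋃ n : ℕ, Set.Iio (-1 - 1 / ((n : ℝ) + 1))) = Set.Iio (-1) := by
      ext x
      simp only [Set.mem_iUnion, Set.mem_Iio]
      constructor
      · rintro ⟨n, hn⟩
        have : 0 < 1 / ((n : ℝ) + 1) := by positivity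
        linarith
      · intro hx
        obtain ⟨n, hn⟩ := exists_nat_one_div_lt (show 0 < -1 - x by linarith)
        exact ⟨n, by linarith⟩
    have hm := tendsto_setIntegral_of_monotone (μ := μ) (f := h)
      (s := fun n : ℕ => Set.Iio (-1 - 1 / ((n : ℝ) + 1))) (fun _ => measurableSet_Iio) (by
        intro m n hmn
        refine Set.Iio_subset_Iio ?_
        have : 1 / ((n : ℝ) + 1) ≤ 1 / ((m : ℝ) + 1) := by gcongr
        linarith) hh.integrableOn
    rw [hU] at hm
    refine tendsto_nhds_unique hm ?_
    have : ∀ n : ℕ, ∫ x in Set.Iio (-1 - 1 / ((n : ℝ) + 1)), h x ∂μ = 0 := by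
      intro n
      have h0 : 0 < 1 / ((n : ℝ) + 1) := by positivity
      have := ht (1 + 1 / ((n : ℝ) + 1)) (by linarith)
      rwa [neg_add'] at this
    simp only [this]
    exact tendsto_const_nhds
  have hIio : ∀ a : ℝ, -1 ≤ a → ∫ x in Set.Iio a, h x ∂μ = 0 := by
    intro a ha
    rw [← h1]
    refine setIntegral_congr_set ?_
    filter_upwards [hneg] with x hx
    exact propext ⟨fun _ => hx, fun _ => lt_of_lt_of_le hx ha⟩
  have hall : ∫ x, h x ∂μ = 0 := by
    rw [← h1, ← setIntegral_univ]
    refine setIntegral_congr_set ?_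
    filter_upwards [hneg] with x hx
    exact propext ⟨fun _ => hx, fun _ => trivial⟩
  have hset : ∀ s, MeasurableSet s → ∫ x in s, h x ∂μ = 0 := by
    intro s hs
    induction s, hs using MeasurableSpace.induction_on_inter
      (BorelSpace.measurable_eq.trans (borel_eq_generateFrom_Iio ℝ)) isPiSystem_Iio with
    | empty => simp
    | basic t ht' =>
      obtain ⟨a, rfl⟩ := ht'
      rcases le_or_gt (-1) a with ha | ha
      · exact hIio a ha
      · simpa using ht (-a) (by linarith)
    | compl t htm ih =>
      have := integral_add_compl htm hh
      linarith
    | iUnion f hd hm ih =>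
      rw [integral_iUnion hm hd hh.integrableOn]
      simp [ih]
  exact hh.ae_eq_zero_of_forall_setIntegral_eq_zero fun s hs _ => hset s hs

theorem convexCyclic_vectors_of_multiplication_operator (μ : Measure ℝ) [IsFiniteMeasure μ]
    (hsupp : ∃ K : Set ℝ, IsCompact K ∧ μ Kᶜ = 0)
    (hμ : μ (Set.Ici (-1 : ℝ)) = 0) (g : Lp ℝ 2 μ) :
    Dense (convexHull ℝ
      {h : Lp ℝ 2 μ | ∃ n : ℕ, (h : ℝ → ℝ) =ᵐ[μ] fun x => x ^ n * (g : ℝ → ℝ) x})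
    ↔ ∀ᵐ x ∂μ, 0 < |(g : ℝ → ℝ) x| := by
  have hneg : ∀ᵐ x ∂μ, x < -1 := by
    rw [ae_iff]
    convert hμ using 2
    ext x
    simp
  obtain ⟨R, hR⟩ : ∃ R : ℝ, ∀ᵐ x ∂μ, |x| ≤ R := by
    obtain ⟨K, hK, hK0⟩ := hsupp
    obtain ⟨R, hR⟩ := hK.isBounded.exists_norm_le
    refine ⟨R, ?_⟩
    have : ∀ᵐ x ∂μ, x ∈ K := hK0
    filter_upwards [this] with x hx
    exact hR x hx
  constructor
  · intro hd
    set S : Set ℝ := {x | (g : ℝ → ℝ) x = 0} with hSdef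
    have hS : MeasurableSet S := (Lp.stronglyMeasurable g).measurable (measurableSet_singleton 0)
    set v : Lp ℝ 2 μ := indicatorConstLp 2 hS (measure_ne_top μ S) (1 : ℝ) with hv
    have hz : ∀ w ∈ convexHull ℝ
        {h : Lp ℝ 2 μ | ∃ n : ℕ, (h : ℝ → ℝ) =ᵐ[μ] fun x => x ^ n * (g : ℝ → ℝ) x},
        innerSL ℝ v w = 0 := by
      have hsub : {h : Lp ℝ 2 μ | ∃ n : ℕ, (h : ℝ → ℝ) =ᵐ[μ] fun x => x ^ n * (g : ℝ → ℝ) x} ⊆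
          (((innerSL ℝ v).toLinearMap.ker : Submodule ℝ (Lp ℝ 2 μ)) : Set (Lp ℝ 2 μ)) := by
        rintro w ⟨n, hn⟩
        change inner ℝ v w = 0
        rw [hv, L2.inner_indicatorConstLp_one]
        refine setIntegral_eq_zero_of_ae_eq_zero ?_
        filter_upwards [hn] with x hx hxS
        rw [hx]
        simp [show (g : ℝ → ℝ) x = 0 from hxS]
      intro w hw
      exact convexHull_min hsub (Submodule.convex _) hw
    have hz' : ∀ w, innerSL ℝ v w = 0 := by
      intro w
      have hcl : IsClosed {w | innerSL ℝ v w = 0} :=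
        isClosed_eq (innerSL ℝ v).continuous continuous_const
      exact hcl.closure_subset_iff.2 hz (hd w)
    have hv0 : v = 0 := by
      have := hz' v
      exact inner_self_eq_zero.1 this
    have e1 : (v : ℝ → ℝ) =ᵐ[μ] S.indicator fun _ => (1 : ℝ) := indicatorConstLp_coeFn
    have e2 := (Lp.eq_zero_iff_ae_eq_zero).1 hv0
    filter_upwards [e1, e2] with x h1 h2
    refine abs_pos.2 fun hx => ?_
    rw [h2, Set.indicator_of_mem (show x ∈ S from hx)] at h1
    simp at h1
  · intro hg
    by_contra hd
    simp only [Dense, not_forall] at hd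
    obtain ⟨w, hw⟩ := hd
    obtain ⟨f, u, hf1, hf2⟩ := geometric_hahn_banach_closed_point
      (convex_convexHull ℝ _).closure isClosed_closure hw
    set v := (InnerProductSpace.toDual ℝ (Lp ℝ 2 μ)).symm f with hv
    have hfv : ∀ z, f z = inner ℝ v z := by
      intro z
      rw [hv, InnerProductSpace.toDual_symm_apply]
    have hmem : ∀ n : ℕ, MemLp (fun x => x ^ n * (g : ℝ → ℝ) x) 2 μ := by
      intro n
      refine MemLp.of_le_mul (c := R ^ n) (Lp.memLp g)
        ((by fun_prop : AEStronglyMeasurable (fun x : ℝ => x ^ n) μ).mul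
          (Lp.aestronglyMeasurable g)) ?_
      filter_upwards [hR] with x hx
      rw [norm_mul, norm_pow]
      gcongr
      exact hx
    have hle : ∀ n : ℕ, f ((hmem n).toLp _) < u := fun n =>
      hf1 _ (subset_closure (subset_convexHull ℝ _ ⟨n, (hmem n).coeFn_toLp⟩))
    have hint : Integrable (fun x => (v : ℝ → ℝ) x * (g : ℝ → ℝ) x) μ :=
      (Lp.memLp v).integrable_mul (Lp.memLp g)
    have hzero := aux_zero μ R _ hint hR hneg u (fun n => by
      refine le_of_eq_of_le ?_ (hle n).le
      rw [hfv, L2.inner_def]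
      refine integral_congr_ae ?_
      filter_upwards [(hmem n).coeFn_toLp] with x hx
      rw [hx]
      simp
      ring)
    have hv0 : v = 0 := by
      rw [Lp.eq_zero_iff_ae_eq_zero]
      filter_upwards [hzero, hg] with x hx hgx
      exact (mul_eq_zero.1 hx).resolve_right (abs_pos.1 hgx)
    have h1 := hle 0
    rw [hfv, hv0, inner_zero_left] at h1
    rw [hfv, hv0, inner_zero_left] at hf2
    linarith
end
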